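/- arXiv:1102.4985 — 2 statements merged into one kernel-verified Lean document; each statement's English description precedes it below -/
import Mathlib

section
/- Let F be an algebraically closed field of characteristic 0 and let f be the partition function of a k-color vertex model over F. Then f is the partition function of a k-color vertex model y whose moment matrix M_y = (y_{α+β}) has rank at most r if and only if for each graph G = (V,E), each U ⊆ V with |U| = r+1, and each s : U → V\U, Σ_{π∈S_U} sgn(π) f(G/(s∘π)) = 0. -/
structure MGraph : Type 1 where
  V : Type
  E : Type
  [fintV : Fintype V]
  [fintE : Fintype E]
  [decV : DecidableEq V]
  [decE : DecidableEq E]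
  ends : E → V × V

attribute [instance] MGraph.fintV MGraph.fintE MGraph.decV MGraph.decE

namespace MGraph

/-- multiplicity with which vertex `v` occurs among the endpoints of edge `e`
(a loop counts twice). -/
def inc (G : MGraph) (v : G.V) (e : G.E) : ℕ :=
  (if (G.ends e).1 = v then 1 else 0) + (if (G.ends e).2 = v then 1 else 0)

/-- `κ(δ(v))` : the incidence vector in `ℕ^k` of the multiset of colors seen at `v`. -/
def degVec (G : MGraph) {k : ℕ} (κ : G.E → Fin k) (v : G.V) : Fin k → ℕ :=
  fun c => ∑ e : G.E, if κ e = c then G.inc v e else 0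

/-- the partition function of the `k`-color vertex model `y`. -/
def pf {F : Type} [CommRing F] (k : ℕ) (y : (Fin k → ℕ) → F) (G : MGraph) : F :=
  ∑ κ : G.E → Fin k, ∏ v : G.V, y (G.degVec κ v)

def empty : MGraph where
  V := Empty
  E := Empty
  ends := Empty.elim

def disjUnion (G H : MGraph) : MGraph where
  V := G.V ⊕ H.V
  E := G.E ⊕ H.E
  ends := Sum.elim (fun e => (Sum.inl (G.ends e).1, Sum.inl (G.ends e).2))
    (fun e => (Sum.inr (H.ends e).1, Sum.inr (H.ends e).2))

/-- `G_t` : add the edges `{u t(u) | u ∈ U}`. -/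
def addEdges (G : MGraph) (U : Finset G.V) (t : {v // v ∈ U} → G.V) : MGraph where
  V := G.V
  E := G.E ⊕ {v // v ∈ U}
  ends := Sum.elim G.ends (fun u => (u.1, t u))

/-- `G/t` : add the edges `{u t(u) | u ∈ U}` and contract them. -/
noncomputable def contract (G : MGraph) (U : Finset G.V) (t : {v // v ∈ U} → G.V) : MGraph :=
  letI s : Setoid G.V := Relation.EqvGen.setoid (fun a b => ∃ h : a ∈ U, t ⟨a, h⟩ = b)
  letI : DecidableEq (Quotient s) := Classical.decEq _
  letI : Fintype (Quotient s) := Fintype.ofSurjective (Quotient.mk s)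
    (fun q => Quot.exists_rep q)
  { V := Quotient s
    E := G.E
    ends := fun e => (Quotient.mk s (G.ends e).1, Quotient.mk s (G.ends e).2) }

/-- isomorphism of multigraphs. -/
structure Iso (G H : MGraph) where
  vEquiv : G.V ≃ H.V
  eEquiv : G.E ≃ H.E
  ends_eq : ∀ e, H.ends (eEquiv e) = Prod.map vEquiv vEquiv (G.ends e) ∨
    H.ends (eEquiv e) = (Prod.map vEquiv vEquiv (G.ends e)).swap

end MGraph



namespace PFR

section Proj
variable {H H' : Type} [Fintype H] [DecidableEq H] [Fintype H'] [DecidableEq H'] {k : ℕ}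

open Classical in
/-- the tensor of a matching -/
noncomputable def dlt {H : Type} (k : ℕ) (N : H → H) (j : H → Fin k) : ℚ :=
  if ∀ h, j (N h) = j h then 1 else 0

abbrev Mat (H : Type) := {N : H → H // Function.Involutive N ∧ ∀ h, N h ≠ h}

noncomputable instance : Fintype (Mat H) := Fintype.ofFinite _

def B (k : ℕ) (H : Type) : Submodule ℚ ((H → Fin k) → ℚ) :=
  Submodule.span ℚ (Set.range fun N : Mat H => dlt k N.1)

lemma uniq {x : (H → Fin k) → ℚ} (hx : x ∈ B k H)
    (h : ∀ b ∈ B k H, ∑ j, x j * b j = 0) : x = 0 := by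
  have h1 := h x hx
  rw [Finset.sum_eq_zero_iff_of_nonneg (fun j _ => mul_self_nonneg _)] at h1
  funext j
  simpa using h1 j (Finset.mem_univ _)

lemma exists_proj (i : H → Fin k) :
    ∃ x ∈ B k H, ∀ b ∈ B k H, ∑ j, x j * b j = b i := by
  let T : (B k H) →ₗ[ℚ] Module.Dual ℚ (B k H) :=
    LinearMap.mk₂ ℚ (fun x b => ∑ j, x.1 j * b.1 j)
      (by intros; simp [add_mul, Finset.sum_add_distrib])
      (by intros; simp [Finset.mul_sum, mul_assoc])
      (by intros; simp [mul_add, Finset.sum_add_distrib])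
      (by intros; simp [Finset.mul_sum, mul_left_comm])
  have hinj : Function.Injective T := by
    rw [injective_iff_map_eq_zero]
    intro x hx
    apply Subtype.ext
    apply uniq x.2
    intro b hb
    exact congrArg (fun t => t ⟨b, hb⟩) hx
  have hsurj : Function.Surjective T :=
    (LinearMap.injective_iff_surjective_of_finrank_eq_finrank
      (Subspace.dual_finrank_eq).symm).1 hinj
  obtain ⟨x, hx⟩ := hsurj ((LinearMap.proj i).comp (B k H).subtype)
  refine ⟨x.1, x.2, fun b hb => ?_⟩
  exact congrArg (fun t => t ⟨b, hb⟩) hx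

noncomputable def P (i : H → Fin k) : (H → Fin k) → ℚ := (exists_proj i).choose

lemma P_mem (i : H → Fin k) : P i ∈ B k H := (exists_proj i).choose_spec.1
lemma P_spec (i : H → Fin k) {b} (hb : b ∈ B k H) : ∑ j, P i j * b j = b i :=
  (exists_proj i).choose_spec.2 b hb

lemma P_uniq {i : H → Fin k} {x : (H → Fin k) → ℚ} (hx : x ∈ B k H)
    (h : ∀ b ∈ B k H, ∑ j, x j * b j = b i) : x = P i := by
  rw [← sub_eq_zero]
  apply uniq (sub_mem hx (P_mem i))
  intro b hb
  simp [sub_mul, h b hb, P_spec i hb]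

/-- generic way to show that a linear map maps `B` to `B` -/
lemma map_B (L : ((H → Fin k) → ℚ) →ₗ[ℚ] ((H' → Fin k) → ℚ))
    (hL : ∀ N : Mat H, L (dlt k N.1) ∈ B k H') {x} (hx : x ∈ B k H) : L x ∈ B k H' := by
  have : B k H ≤ (B k H').comap L := by
    unfold B
    rw [Submodule.span_le]
    rintro _ ⟨N, rfl⟩
    exact hL N
  exact this hx

lemma dlt_mem (N : Mat H) : dlt k N.1 ∈ B k H := Submodule.subset_span ⟨N, rfl⟩

lemma reindex_B (e : H ≃ H') {x : (H → Fin k) → ℚ} (hx : x ∈ B k H) :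
    (fun j : H' → Fin k => x (j ∘ e)) ∈ B k H' := by
  refine map_B (LinearMap.funLeft ℚ ℚ (fun j : H' → Fin k => j ∘ e)) ?_ hx
  intro N
  let N' : Mat H' := ⟨fun h => e (N.1 (e.symm h)), by
    refine ⟨fun h => ?_, fun h hh => ?_⟩
    · simp [N.2.1 (e.symm h)]
    · apply N.2.2 (e.symm h)
      apply e.injective
      simpa using hh⟩
  convert dlt_mem (k := k) N' using 1
  funext j
  simp only [LinearMap.funLeft_apply, dlt, N']
  congr 1
  apply propext
  constructor
  · intro h a
    simpa using h (e.symm a)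
  · intro h a
    simpa using h (e a)

lemma P_equiv (e : H ≃ H') (i j : H' → Fin k) : P (i ∘ e) (j ∘ e) = P i j := by
  have : (fun j : H' → Fin k => P (i ∘ e) (j ∘ e)) = P i := by
    apply P_uniq (reindex_B e (P_mem _))
    intro b hb
    have h1 := P_spec (i ∘ e) (reindex_B e.symm hb)
    have h2 : (i ∘ e) ∘ e.symm = i := by ext; simp
    rw [h2] at h1
    rw [← h1]
    refine Fintype.sum_equiv (e.arrowCongr (Equiv.refl _)).symm _ _ ?_
    intro j
    have : (j ∘ e) ∘ e.symm = j := by ext; simp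
    show P (i ∘ e) (j ∘ e) * b j = P (i ∘ e) (j ∘ e) * b ((j ∘ e) ∘ e.symm)
    rw [this]
  exact congrFun this j

def pr {α : Type} (a b : α) : Bool → α := fun t => if t then a else b

lemma tens_B {x : (H → Fin k) → ℚ} (hx : x ∈ B k H) :
    (fun j : H ⊕ Bool → Fin k =>
      if j (Sum.inr true) = j (Sum.inr false) then x (j ∘ Sum.inl) else 0) ∈ B k (H ⊕ Bool) := by
  let L : ((H → Fin k) → ℚ) →ₗ[ℚ] ((H ⊕ Bool → Fin k) → ℚ) :=
    { toFun := fun x j => if j (Sum.inr true) = j (Sum.inr false) then x (j ∘ Sum.inl) else 0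
      map_add' := by intro x y; funext j; simp only [Pi.add_apply]; split_ifs <;> simp
      map_smul' := by intro x y; funext j; simp }
  refine map_B L ?_ hx
  intro N
  let N' : Mat (H ⊕ Bool) := ⟨Sum.map N.1 (fun b => !b), by
    refine ⟨?_, ?_⟩
    · rintro (h | b) <;> simp [N.2.1 _]
    · rintro (h | b) <;> simp [N.2.2 _]⟩
  convert dlt_mem (k := k) N' using 1
  funext j
  simp only [L, LinearMap.coe_mk, AddHom.coe_mk, dlt, N', Sum.forall, Bool.forall_bool]
  by_cases h : j (Sum.inr true) = j (Sum.inr false)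
  · simp [h]
  · have h' : ¬ j (Sum.inr false) = j (Sum.inr true) := fun e => h e.symm
    simp [h]

lemma contr_B {x : (H ⊕ Bool → Fin k) → ℚ} (hx : x ∈ B k (H ⊕ Bool)) :
    (fun j : H → Fin k => ∑ c, x (Sum.elim j (fun _ => c))) ∈ B k H := by
  let L : ((H ⊕ Bool → Fin k) → ℚ) →ₗ[ℚ] ((H → Fin k) → ℚ) :=
    { toFun := fun x j => ∑ c, x (Sum.elim j (fun _ => c))
      map_add' := by intro x y; funext j; simp [Finset.sum_add_distrib]
      map_smul' := by intro x y; funext j; simp [Finset.mul_sum] }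
  refine map_B L ?_ hx
  rintro ⟨N, hN, hN'⟩
  show (fun j => ∑ c, dlt k N (Sum.elim j (fun _ => c))) ∈ _
  rcases hT : N (Sum.inr true) with a | b
  · -- `true` matched into H
    rcases hF : N (Sum.inr false) with b | b
    swap
    · exfalso
      cases b
      · exact hN' _ hF
      · rw [← hF, hN] at hT; cases hT
    have hTa : N (Sum.inl a) = Sum.inr true := by rw [← hT, hN]
    have hFb : N (Sum.inl b) = Sum.inr false := by rw [← hF, hN]
    have hab : a ≠ b := by rintro rfl; rw [hTa] at hFb; simp at hFb
    -- the others
    have hoth : ∀ h, h ≠ a → h ≠ b → ∃ h', N (Sum.inl h) = Sum.inl h' := by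
      intro h ha hb
      rcases hh : N (Sum.inl h) with h' | t
      · exact ⟨h', rfl⟩
      · exfalso
        have : N (Sum.inr t) = Sum.inl h := by rw [← hh, hN]
        cases t
        · rw [hF] at this; simp at this; exact hb this.symm
        · rw [hT] at this; simp at this; exact ha this.symm
    let M : H → H := fun h => if h = a then b else if h = b then a else
      (N (Sum.inl h)).elim id (fun _ => h)
    have Ma : M a = b := by simp [M]
    have Mb : M b = a := by simp [M]
    have Mo : ∀ h, h ≠ a → h ≠ b → N (Sum.inl h) = Sum.inl (M h) := by
      intro h ha hb
      obtain ⟨h', e⟩ := hoth h ha hb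
      simp [M, ha, hb, e]
    have hM : Function.Involutive M ∧ ∀ h, M h ≠ h := by
      constructor
      · intro h
        by_cases ha : h = a
        · rw [ha, Ma, Mb]
        by_cases hb : h = b
        · rw [hb, Mb, Ma]
        have h1 := Mo h ha hb
        have h2 : N (Sum.inl (M h)) = Sum.inl h := by rw [← h1, hN]
        have h3 : M h ≠ a := by intro e; rw [e, hTa] at h2; cases h2
        have h4 : M h ≠ b := by intro e; rw [e, hFb] at h2; cases h2
        have h5 := Mo _ h3 h4
        rw [h2] at h5
        exact (Sum.inl_injective h5).symm
      · intro h
        by_cases ha : h = a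
        · rw [ha, Ma]; exact hab.symm
        by_cases hb : h = b
        · rw [hb, Mb]; exact hab
        intro e
        have h1 := Mo h ha hb
        rw [e] at h1
        exact hN' _ h1
    convert dlt_mem (k := k) (⟨M, hM⟩ : Mat H) using 1
    funext j
    have key : ∀ c, (∀ h, (Sum.elim j (fun _ => c) : H ⊕ Bool → Fin k) (N h) =
        (Sum.elim j (fun _ => c) : H ⊕ Bool → Fin k) h) ↔ (j a = c ∧ ∀ h, j (M h) = j h) := by
      intro c
      constructor
      · intro h
        have e1 := h (Sum.inr true)
        have e2 := h (Sum.inr false)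
        simp only [hT, hF, Sum.elim_inl, Sum.elim_inr] at e1 e2
        refine ⟨e1, fun t => ?_⟩
        by_cases ha : t = a
        · rw [ha, Ma, e1, e2]
        by_cases hb : t = b
        · rw [hb, Mb, e1, e2]
        simpa [Mo t ha hb] using h (Sum.inl t)
      · rintro ⟨h1, h2⟩
        have h3 : j b = c := by rw [← Ma, h2, h1]
        rintro (t | t)
        · by_cases ha : t = a
          · rw [ha, hTa]; simp [h1]
          by_cases hb : t = b
          · rw [hb, hFb]; simp [h3]
          simpa [Mo t ha hb] using h2 t
        · cases t
          · simp [hF, h3]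
          · simp [hT, h1]
    simp only [dlt, key]
    by_cases hh : ∀ h, j (M h) = j h
    · simp only [hh, implies_true, and_true, if_true]
      rw [Finset.sum_eq_single (j a)] <;> simp +contextual [eq_comm]
    · simp [hh]
  · have hb : b = false := by
      cases b
      · rfl
      · exact absurd hT (hN' _)
    subst hb
    have hF : N (Sum.inr false) = Sum.inr true := by rw [← hT, hN]
    have hoth : ∀ h, ∃ h', N (Sum.inl h) = Sum.inl h' := by
      intro h
      rcases hh : N (Sum.inl h) with h' | t
      · exact ⟨h', rfl⟩
      · exfalso
        have : N (Sum.inr t) = Sum.inl h := by rw [← hh, hN]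
        cases t
        · rw [hF] at this; simp at this
        · rw [hT] at this; simp at this
    choose M Mo using hoth
    have hM : Function.Involutive M ∧ ∀ h, M h ≠ h := by
      constructor
      · intro h
        have := hN (Sum.inl h)
        rw [Mo, Mo] at this
        exact Sum.inl_injective this
      · intro h e
        apply hN' (Sum.inl h)
        rw [Mo, e]
    convert (B k H).smul_mem (k : ℚ) (dlt_mem (k := k) (⟨M, hM⟩ : Mat H)) using 1
    funext j
    have key : ∀ c, (∀ h, (Sum.elim j (fun _ => c) : H ⊕ Bool → Fin k) (N h) =
        (Sum.elim j (fun _ => c) : H ⊕ Bool → Fin k) h) ↔ (∀ h, j (M h) = j h) := by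
      intro c
      simp [Sum.forall, Mo, hT, hF]
    simp only [dlt, key, Pi.smul_apply]
    simp

lemma P_contr (i j : H → Fin k) (a b : Fin k) :
    ∑ c, P (Sum.elim i (fun _ => c) : H ⊕ Bool → Fin k) (Sum.elim j (pr a b)) =
      if a = b then P i j else 0 := by
  have key : (fun j : H ⊕ Bool → Fin k =>
      if j (Sum.inr true) = j (Sum.inr false) then P i (j ∘ Sum.inl) else 0) =
      ∑ c, P (Sum.elim i (fun _ => c) : H ⊕ Bool → Fin k) := by
    rw [← sub_eq_zero]
    apply uniq (sub_mem (tens_B (P_mem i)) (Submodule.sum_mem _ fun c _ => P_mem _))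
    intro x hx
    simp only [Pi.sub_apply, sub_mul, Finset.sum_sub_distrib, Finset.sum_apply, Finset.sum_mul]
    rw [Finset.sum_comm (s := (Finset.univ : Finset (H ⊕ Bool → Fin k))) (t := (Finset.univ : Finset (Fin k)))]
    simp only [P_spec _ hx]
    have h1 := P_spec i (contr_B hx)
    rw [← h1, sub_eq_zero]
    simp only [Finset.mul_sum]
    rw [← Fintype.sum_prod_type' (f := fun (j : H → Fin k) c => P i j * x (Sum.elim j fun _ => c))]
    symm
    apply Finset.sum_of_injOn (fun p : (H → Fin k) × Fin k => (Sum.elim p.1 (fun _ => p.2)))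
    · rintro ⟨p, c⟩ _ ⟨q, d⟩ _ h
      have h1 := congrArg (fun f => f ∘ Sum.inl) h
      have h2 := congrFun h (Sum.inr true)
      simp at h1 h2
      simp [h1, h2]
    · intro _ _; simp
    · intro t _ ht
      have : ¬ t (Sum.inr true) = t (Sum.inr false) := by
        intro e
        apply ht
        refine ⟨(t ∘ Sum.inl, t (Sum.inr true)), by simp, ?_⟩
        funext z
        rcases z with z | z
        · rfl
        · cases z
          · exact e
          · rfl
      simp [this]
    · rintro ⟨p, c⟩ _
      simp
  have := congrFun key (Sum.elim j (pr a b))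
  rw [Finset.sum_apply] at this
  rw [← this]
  simp [pr]

lemma P_empty [IsEmpty H] (i j : H → Fin k) : P i j = 1 := by
  have : (fun _ => 1 : (H → Fin k) → ℚ) = P i := by
    apply P_uniq
    · convert dlt_mem (k := k) (⟨id, fun _ => rfl, fun h => isEmptyElim h⟩ : Mat H) using 1
      funext j
      simp [dlt]
    · intro b _
      simp [Subsingleton.elim default i]
  rw [← this]

lemma P_expand (i : H → Fin k) : ∃ c : Mat H → ℚ, ∀ j, P i j = ∑ N, c N * dlt k N.1 j := by
  obtain ⟨c, hc⟩ := (Submodule.mem_span_range_iff_exists_fun ℚ).1 (P_mem i)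
  refine ⟨c, fun j => ?_⟩
  rw [← hc]
  simp

end Proj

section Act
variable {H H' V : Type} [Fintype H] [DecidableEq H] [Fintype H'] [DecidableEq H']
  [Fintype V] [DecidableEq V] {k : ℕ}

def cnt {C : Type} [DecidableEq C] (i : H → C) : C → ℕ := fun c => ∑ h, if i h = c then 1 else 0

def degJ {C : Type} [DecidableEq C] (vtx : H → V) (i : H → C) (v : V) : C → ℕ :=
  fun c => ∑ h, if vtx h = v then (if i h = c then 1 else 0) else 0

lemma cnt_card {C : Type} [DecidableEq C] (i : H → C) (c : C) :
    cnt i c = Fintype.card {h // i h = c} := by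
  simp [cnt, Fintype.card_subtype]

lemma degJ_eq {C : Type} [DecidableEq C] (vtx : H → V) (i : H → C) (v : V) :
    degJ vtx i v = cnt (fun h : {h // vtx h = v} => i h.1) := by
  funext c
  simp only [degJ, cnt]
  rw [← Finset.sum_filter]
  exact Finset.sum_subtype _ (by simp) _

lemma exists_equiv {C : Type} [DecidableEq C] (i : H → C) (i' : H' → C) (h : cnt i = cnt i') :
    ∃ e : H ≃ H', ∀ h, i' (e h) = i h := by
  have h1 : ∀ c, Nonempty ({h // i h = c} ≃ {h // i' h = c}) := by
    intro c
    have := congrFun h c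
    rw [cnt_card, cnt_card] at this
    exact ⟨Fintype.equivOfCardEq this⟩
  let e := fun c => (h1 c).some
  refine ⟨((Equiv.sigmaFiberEquiv i).symm.trans (Equiv.sigmaCongrRight e)).trans
    (Equiv.sigmaFiberEquiv i'), fun h => ?_⟩
  exact (e (i h) ⟨h, rfl⟩).2

lemma cnt_fst {C : Type} [DecidableEq C] [Fintype C] (α : C → ℕ) :
    cnt (Sigma.fst : (Σ c, Fin (α c)) → C) = α := by
  funext c
  simp only [cnt, Fintype.sum_sigma]
  rw [Finset.sum_eq_single c]
  · simp
  · intro b _ hb; simp [hb]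
  · simp

lemma cnt_comp {C : Type} [DecidableEq C] (e : H ≃ H') (i : H' → C) : cnt (i ∘ e) = cnt i := by
  funext c
  exact Equiv.sum_comp e (fun h => if i h = c then 1 else 0)

variable {A : Type} [CommRing A]

def act (g : Fin k → Fin k → A) (y : (Fin k → ℕ) → A) (α : Fin k → ℕ) : A :=
  ∑ j : (Σ c, Fin (α c)) → Fin k, (∏ h, g h.1 (j h)) * y (cnt j)

lemma act_eq (g : Fin k → Fin k → A) (y : (Fin k → ℕ) → A) (i : H → Fin k) :
    act g y (cnt i) = ∑ j : H → Fin k, (∏ h, g (i h) (j h)) * y (cnt j) := by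
  obtain ⟨e, he⟩ := exists_equiv i (Sigma.fst : (Σ c, Fin (cnt i c)) → Fin k) (cnt_fst _).symm
  unfold act
  refine Fintype.sum_equiv (e.arrowCongr (Equiv.refl _)).symm _ _ ?_
  intro j
  show _ = (∏ h, g (i h) ((j ∘ e) h)) * y (cnt (j ∘ e))
  rw [cnt_comp]
  congr 1
  rw [← Equiv.prod_comp e]
  simp [he]

lemma prod_act (g : Fin k → Fin k → A) (y : (Fin k → ℕ) → A) (vtx : H → V) (i : H → Fin k) :
    ∏ v, act g y (degJ vtx i v) =
      ∑ j : H → Fin k, (∏ h, g (i h) (j h)) * ∏ v, y (degJ vtx j v) := by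
  simp only [degJ_eq, act_eq]
  rw [Finset.prod_univ_sum, Fintype.piFinset_univ]
  symm
  let e : (H → Fin k) ≃ (∀ v : V, {h // vtx h = v} → Fin k) :=
    { toFun := fun j v h => j h.1
      invFun := fun f h => f (vtx h) ⟨h, rfl⟩
      left_inv := fun j => rfl
      right_inv := fun f => by
        funext v ⟨h, hh⟩
        subst hh
        rfl }
  refine Fintype.sum_equiv e _ _ ?_
  intro j
  rw [Finset.prod_mul_distrib]
  congr 1
  rw [← Equiv.prod_comp (Equiv.sigmaFiberEquiv vtx), Fintype.prod_sigma]
  rfl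

lemma sum_ind {Ed : Type} [Fintype Ed] [DecidableEq Ed] (Q : (Ed ⊕ Ed → Fin k) → A)
    (w : (Ed ⊕ Ed → Fin k) → A)
    (h1 : ∀ j, (∀ a, j (Sum.inl a) = j (Sum.inr a)) → w j = 1)
    (h0 : ∀ j, ¬ (∀ a, j (Sum.inl a) = j (Sum.inr a)) → w j = 0) :
    ∑ j, w j * Q j = ∑ κ : Ed → Fin k, Q (Sum.elim κ κ) := by
  symm
  apply Finset.sum_of_injOn (fun κ : Ed → Fin k => (Sum.elim κ κ : Ed ⊕ Ed → Fin k))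
  · intro κ _ κ' _ h
    exact congrArg (fun f => f ∘ Sum.inl) h
  · intro _ _; simp
  · intro j _ hj
    rw [h0, zero_mul]
    intro h
    apply hj
    refine ⟨j ∘ Sum.inl, by simp, ?_⟩
    funext z
    rcases z with z | z
    · rfl
    · exact h z
  · intro κ _
    rw [h1 _ (fun a => rfl), one_mul]

def gvtx (G : MGraph) : G.E ⊕ G.E → G.V :=
  Sum.elim (fun e => (G.ends e).1) (fun e => (G.ends e).2)

lemma degVec_eq (G : MGraph) (κ : G.E → Fin k) (v : G.V) :
    G.degVec κ v = degJ (gvtx G) (Sum.elim κ κ) v := by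
  funext c
  simp only [MGraph.degVec, degJ, MGraph.inc, gvtx, Fintype.sum_sum_type, Sum.elim_inl,
    Sum.elim_inr, ← Finset.sum_add_distrib]
  refine Finset.sum_congr rfl fun e _ => ?_
  by_cases h1 : κ e = c <;> by_cases h2 : (G.ends e).1 = v <;>
    by_cases h3 : (G.ends e).2 = v <;> simp [h1, h2, h3]

lemma pf_act (g : Fin k → Fin k → A) (hg : ∀ a b, ∑ c, g c a * g c b = if a = b then 1 else 0)
    (y : (Fin k → ℕ) → A) (G : MGraph) : MGraph.pf k (act g y) G = MGraph.pf k y G := by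
  simp only [MGraph.pf, degVec_eq, prod_act]
  rw [Finset.sum_comm]
  simp only [← Finset.sum_mul]
  have key : ∀ j : G.E ⊕ G.E → Fin k, ∑ κ : G.E → Fin k,
      ∏ h, g ((Sum.elim κ κ : G.E ⊕ G.E → Fin k) h) (j h) =
      ∏ e, if j (Sum.inl e) = j (Sum.inr e) then 1 else 0 := by
    intro j
    simp only [← hg, Fintype.prod_sum_type, Sum.elim_inl, Sum.elim_inr, ← Finset.prod_mul_distrib]
    rw [Finset.prod_univ_sum, Fintype.piFinset_univ]
  simp only [key]
  apply sum_ind (fun j => ∏ v, y (degJ (gvtx G) j v))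
  · intro j h; simp [h]
  · intro j h
    push Not at h
    obtain ⟨a, ha⟩ := h
    exact Finset.prod_eq_zero (Finset.mem_univ a) (by simp [ha])

lemma exists_edges (N : Mat H) : ∃ (Ed : Type) (_ : Fintype Ed) (_ : DecidableEq Ed)
    (e : Ed ⊕ Ed ≃ H), ∀ a, N.1 (e (Sum.inl a)) = e (Sum.inr a) := by
  obtain ⟨N, hN, hN'⟩ := N
  let f := Fintype.equivFin H
  have hf : ∀ h, f (N h) ≠ f h := fun h e => hN' h (f.injective e)
  refine ⟨{h // f h < f (N h)}, inferInstance, inferInstance,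
    Equiv.ofBijective (Sum.elim (fun a => a.1) (fun a => N a.1)) ⟨?_, ?_⟩, fun a => rfl⟩
  · rintro (⟨a, ha⟩ | ⟨a, ha⟩) (⟨b, hb⟩ | ⟨b, hb⟩) h
    · simp at h; simp [h]
    · simp at h; subst h; rw [hN] at ha; exact absurd ha hb.asymm
    · simp at h; subst h; rw [hN] at hb; exact absurd ha hb.asymm
    · simp [hN.injective.eq_iff] at h; simp [h]
  · intro h
    rcases lt_or_gt_of_ne (hf h) with h1 | h1
    · refine ⟨Sum.inr ⟨N h, by rw [hN]; exact h1⟩, hN h⟩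
    · exact ⟨Sum.inl ⟨h, h1⟩, rfl⟩

def sgraph {Ed : Type} [Fintype Ed] [DecidableEq Ed] (vtx : H → V) (e : Ed ⊕ Ed ≃ H) : MGraph where
  V := V
  E := Ed
  ends := fun a => (vtx (e (Sum.inl a)), vtx (e (Sum.inr a)))

lemma degJ_comp {C : Type} [DecidableEq C] (e : H ≃ H') (vtx : H' → V) (i : H' → C) (v : V) :
    degJ (vtx ∘ e) (i ∘ e) v = degJ vtx i v := by
  funext c
  exact Equiv.sum_comp e (fun h => if vtx h = v then (if i h = c then 1 else 0) else 0)

lemma pf_sgraph {F : Type} [Field F] [CharZero F] {Ed : Type} [Fintype Ed] [DecidableEq Ed]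
    (vtx : H → V) (e : Ed ⊕ Ed ≃ H) (N : Mat H) (hN : ∀ a, N.1 (e (Sum.inl a)) = e (Sum.inr a))
    (y : (Fin k → ℕ) → F) :
    MGraph.pf k y (sgraph vtx e) = ∑ j : H → Fin k, (dlt k N.1 j : F) * ∏ v, y (degJ vtx j v) := by
  have h1 : gvtx (sgraph vtx e) = vtx ∘ e := by
    funext z; rcases z with z | z <;> rfl
  have h2 : ∑ j : H → Fin k, (dlt k N.1 j : F) * ∏ v, y (degJ vtx j v) =
      ∑ j : Ed ⊕ Ed → Fin k, (dlt k N.1 (j ∘ e.symm) : F) * ∏ v, y (degJ (vtx ∘ e) j v) := by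
    symm
    refine Fintype.sum_equiv (e.arrowCongr (Equiv.refl _)) _ _ ?_
    intro j
    show _ = (dlt k N.1 (j ∘ e.symm) : F) * ∏ v, y (degJ vtx (j ∘ e.symm) v)
    congr 2
    funext v
    rw [← degJ_comp e]
    congr 2
    ext; simp
  rw [h2, sum_ind (fun j => ∏ v, y (degJ (vtx ∘ e) j v))]
  · simp only [MGraph.pf, degVec_eq, h1]
    rfl
  · intro j h
    have : ∀ h, (j ∘ e.symm) (N.1 h) = (j ∘ e.symm) h := by
      intro z
      obtain ⟨z, rfl⟩ := e.surjective z
      rcases z with a | a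
      · simp [hN, h]
      · have : N.1 (e (Sum.inr a)) = e (Sum.inl a) := by rw [← hN, N.2.1]
        simp [this, h]
    simp only [dlt, this, implies_true, if_true, Rat.cast_one]
  · intro j h
    have : ¬ ∀ h, (j ∘ e.symm) (N.1 h) = (j ∘ e.symm) h := by
      intro h'
      apply h
      intro a
      simpa [hN] using (h' (e (Sum.inl a))).symm
    simp only [dlt, this, if_false, Rat.cast_zero]

end Act

section Efun
open MvPolynomial

lemma mono_prod {σ F : Type} [Field F] (m : σ →₀ ℕ) :
    ∃ (W : Type) (_ : Fintype W) (_ : DecidableEq W) (γ : W → σ),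
      (monomial m (1 : F)) = ∏ w, X (γ w) := by
  classical
  refine ⟨Σ p : m.support, Fin (m p), inferInstance, inferInstance, fun w => w.1.1, ?_⟩
  rw [monomial_eq, Fintype.prod_sigma]
  simp only [Finset.prod_const, Finset.card_univ, Fintype.card_fin, Finsupp.prod, map_one, one_mul]
  exact (Finset.prod_coe_sort m.support (fun p => (X p : MvPolynomial σ F) ^ m p)).symm

lemma lin_zero {σ F : Type} [Field F] (L : MvPolynomial σ F →ₗ[F] F)
    (h : ∀ (W : Type) [Fintype W] [DecidableEq W] (γ : W → σ), L (∏ w, X (γ w)) = 0)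
    (T : MvPolynomial σ F) : L T = 0 := by
  have : L = 0 := by
    apply (basisMonomials σ F).ext
    intro m
    obtain ⟨W, _, _, γ, e⟩ := mono_prod (F := F) m
    simp only [coe_basisMonomials, e, h, LinearMap.zero_apply]
  simp [this]

variable {F : Type} [Field F] [CharZero F] {k : ℕ}

noncomputable def Ef (k : ℕ) (F : Type) [Field F] [CharZero F] :
    MvPolynomial (Fin k × Fin k) F →ₗ[F] F :=
  (basisMonomials (Fin k × Fin k) F).constr F fun m =>
    ((P (fun h : (Σ p, Fin (m p)) => h.1.1) (fun h => h.1.2) : ℚ) : F)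

lemma P_pairs {H H' : Type} [Fintype H] [DecidableEq H] [Fintype H'] [DecidableEq H']
    (i j : H → Fin k) (i' j' : H' → Fin k)
    (h : cnt (fun h => (i h, j h)) = cnt (fun h => (i' h, j' h))) : P i j = P i' j' := by
  obtain ⟨e, he⟩ := exists_equiv _ _ h
  have h1 : i = i' ∘ e := by funext x; exact (congrArg Prod.fst (he x)).symm
  have h2 : j = j' ∘ e := by funext x; exact (congrArg Prod.snd (he x)).symm
  rw [h1, h2, P_equiv]

lemma Ef_prod {H : Type} [Fintype H] [DecidableEq H] (i j : H → Fin k) :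
    Ef k F (∏ h, X (i h, j h)) = (P i j : F) := by
  have : (∏ h, X (i h, j h) : MvPolynomial (Fin k × Fin k) F) =
      basisMonomials (Fin k × Fin k) F (∑ h, Finsupp.single (i h, j h) 1) := by
    rw [coe_basisMonomials]
    exact (monomial_sum_one _ _).symm
  rw [this, Ef, Module.Basis.constr_basis]
  congr 1
  apply P_pairs
  have h2 : ∀ m : (Fin k × Fin k) →₀ ℕ,
    cnt (fun h : (Σ p, Fin (m p)) => (h.1.1, h.1.2)) = m := fun m => cnt_fst m
  rw [h2]
  funext p
  simp [cnt, Finsupp.finsetSum_apply, Finsupp.single_apply]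

lemma Ef_one : Ef k F 1 = 1 := by
  have := Ef_prod (F := F) (k := k) (H := Empty) Empty.elim Empty.elim
  rw [P_empty] at this
  simpa using this

noncomputable def OrthI (k : ℕ) (F : Type) [Field F] : Ideal (MvPolynomial (Fin k × Fin k) F) :=
  Ideal.span (Set.range fun p : Fin k × Fin k =>
    (∑ c, X (c, p.1) * X (c, p.2)) - (if p.1 = p.2 then 1 else 0))

lemma Ef_rel (a b : Fin k) (T : MvPolynomial (Fin k × Fin k) F) :
    Ef k F (T * ((∑ c, X (c, a) * X (c, b)) - (if a = b then 1 else 0))) = 0 := by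
  have key := lin_zero ((Ef k F).comp (LinearMap.mulRight F
    ((∑ c, X (c, a) * X (c, b)) - (if a = b then 1 else 0)))) ?_ T
  · simpa only [LinearMap.comp_apply, LinearMap.mulRight_apply] using key
  intro W _ _ γ
  simp only [LinearMap.comp_apply, LinearMap.mulRight_apply, mul_sub, Finset.mul_sum, map_sub,
    map_sum]
  have h1 : ∀ c, (∏ w, X (γ w) : MvPolynomial (Fin k × Fin k) F) * (X (c, a) * X (c, b)) =
      ∏ h : W ⊕ Bool, X ((Sum.elim (fun w => (γ w).1) (fun _ => c) : W ⊕ Bool → Fin k) h,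
        (Sum.elim (fun w => (γ w).2) (pr a b) : W ⊕ Bool → Fin k) h) := by
    intro c
    simp [pr]
  simp only [h1, Ef_prod]
  rw [← Rat.cast_sum, P_contr]
  have h2 : (∏ w, X (γ w) : MvPolynomial (Fin k × Fin k) F) = ∏ w, X ((γ w).1, (γ w).2) := rfl
  split_ifs with h
  · rw [mul_one, h2, Ef_prod, sub_self]
  · simp

lemma Ef_orth {x : MvPolynomial (Fin k × Fin k) F} (hx : x ∈ OrthI k F) : ∀ T, Ef k F (T * x) = 0 := by
  unfold OrthI at hx
  induction hx using Submodule.span_induction with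
  | mem x h => obtain ⟨⟨a, b⟩, rfl⟩ := h; exact Ef_rel a b
  | zero => simp
  | add x y _ _ h1 h2 => intro T; rw [mul_add, map_add, h1, h2, add_zero]
  | smul a x _ h => intro T; rw [smul_eq_mul, ← mul_assoc, h]

lemma pf_map {A A' : Type} [CommRing A] [CommRing A'] (ψ : A →+* A') (y : (Fin k → ℕ) → A)
    (G : MGraph) : ψ (MGraph.pf k y G) = MGraph.pf k (fun α => ψ (y α)) G := by
  simp [MGraph.pf, map_sum, map_prod]

lemma act_map {A A' : Type} [CommRing A] [CommRing A'] (ψ : A →+* A') (g : Fin k → Fin k → A)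
    (y : (Fin k → ℕ) → A) (α : Fin k → ℕ) :
    ψ (act g y α) = act (fun a b => ψ (g a b)) (fun α => ψ (y α)) α := by
  simp [act, map_sum, map_prod]

noncomputable def gy (y₀ : (Fin k → ℕ) → F) : (Fin k → ℕ) → MvPolynomial (Fin k × Fin k) F :=
  act (fun a b => X (a, b)) (fun α => C (y₀ α))

lemma gy_orth (y₀ : (Fin k → ℕ) → F) (G : MGraph) :
    MGraph.pf k (gy y₀) G - C (MGraph.pf k y₀ G) ∈ OrthI k F := by
  rw [← Ideal.Quotient.eq, pf_map, pf_map C, pf_map]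
  simp only [gy, act_map]
  apply pf_act
  intro a b
  have : (∑ c, X (c, a) * X (c, b)) - (if a = b then 1 else 0) ∈ OrthI k F :=
    Ideal.subset_span ⟨(a, b), rfl⟩
  rw [← Ideal.Quotient.eq] at this
  simp only [map_sum, map_mul] at this
  rw [this]
  split_ifs <;> simp

noncomputable def Ph (y₀ : (Fin k → ℕ) → F) : MvPolynomial (Fin k → ℕ) F →ₗ[F] F :=
  (Ef k F).comp (aeval (gy y₀) : MvPolynomial (Fin k → ℕ) F →ₐ[F] _).toLinearMap

lemma Ph_one (y₀ : (Fin k → ℕ) → F) : Ph y₀ 1 = 1 := by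
  simp [Ph, Ef_one]

lemma Ph_graph (y₀ : (Fin k → ℕ) → F) (G : MGraph) (T : MvPolynomial (Fin k → ℕ) F) :
    Ph y₀ (T * (MGraph.pf k X G - C (MGraph.pf k y₀ G))) = 0 := by
  simp only [Ph, LinearMap.comp_apply, AlgHom.toLinearMap_apply, map_mul]
  apply Ef_orth
  convert gy_orth y₀ G using 1
  rw [map_sub]
  congr 1
  · have := pf_map (aeval (gy y₀) : MvPolynomial (Fin k → ℕ) F →ₐ[F] _).toRingHom
      (X : (Fin k → ℕ) → MvPolynomial (Fin k → ℕ) F) G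
    simpa using this
  · simp [algebraMap_eq]

lemma Ph_prod {H V : Type} [Fintype H] [DecidableEq H] [Fintype V] [DecidableEq V]
    (y₀ : (Fin k → ℕ) → F) (vtx : H → V) (i : H → Fin k) :
    Ph y₀ (∏ v, X (degJ vtx i v)) = ∑ j : H → Fin k, (P i j : F) * ∏ v, y₀ (degJ vtx j v) := by
  simp only [Ph, LinearMap.comp_apply, AlgHom.toLinearMap_apply, map_prod, aeval_X]
  unfold gy
  rw [prod_act, map_sum]
  refine Finset.sum_congr rfl fun j _ => ?_
  rw [← map_prod, mul_comm, ← smul_eq_C_mul, map_smul, Ef_prod, smul_eq_mul, mul_comm]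

end Efun

section Contract
variable {V : Type} [Fintype V] [DecidableEq V] {k : ℕ}

def col (U : Finset V) (t : {v // v ∈ U} → V) (ht : ∀ u, t u ∉ U) (v : V) : {v // v ∉ U} :=
  if h : v ∈ U then ⟨t ⟨v, h⟩, ht _⟩ else ⟨v, h⟩

def mapV {V' : Type} [Fintype V'] [DecidableEq V'] (G : MGraph) (c : G.V → V') : MGraph where
  V := V'
  E := G.E
  ends := fun e => (c (G.ends e).1, c (G.ends e).2)

lemma degJ_map {H V' C : Type} [Fintype H] [DecidableEq V'] [DecidableEq C]
    (vtx : H → V) (c : V → V') (i : H → C) (w : V') :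
    degJ (c ∘ vtx) i w = ∑ v, if c v = w then degJ vtx i v else 0 := by
  funext x
  rw [Finset.sum_apply]
  have : ∀ v, (if c v = w then degJ vtx i v else 0) x =
      ∑ h, if vtx h = v then (if c v = w then (if i h = x then 1 else 0) else 0) else 0 := by
    intro v
    split_ifs with h
    · rfl
    · simp
  simp only [this]
  rw [Finset.sum_comm]
  simp [degJ]

lemma pf_mapV {A V' : Type} [CommRing A] [Fintype V'] [DecidableEq V'] (G : MGraph)
    (c : G.V → V') (y : (Fin k → ℕ) → A) :
    MGraph.pf k y (mapV G c) =
      ∑ κ : G.E → Fin k, ∏ w, y (∑ v, if c v = w then G.degVec κ v else 0) := by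
  have h1 : gvtx (mapV G c) = c ∘ gvtx G := by
    funext z; rcases z with z | z <;> rfl
  simp only [MGraph.pf, degVec_eq, h1]
  refine Finset.sum_congr rfl fun κ _ => Finset.prod_congr rfl fun w _ => ?_
  congr 1
  exact degJ_map (gvtx G) c (Sum.elim κ κ) w

lemma pf_contract {A : Type} [CommRing A] (G : MGraph) (U : Finset G.V)
    (t : {v // v ∈ U} → G.V) (ht : ∀ u, t u ∉ U) (y : (Fin k → ℕ) → A) :
    MGraph.pf k y (G.contract U t) = MGraph.pf k y (mapV G (col U t ht)) := by
  let s : Setoid G.V := Relation.EqvGen.setoid (fun a b => ∃ h : a ∈ U, t ⟨a, h⟩ = b)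
  have hcol : ∀ a b, s a b → col U t ht a = col U t ht b := by
    intro a b h
    change Relation.EqvGen _ a b at h
    induction h with
    | rel a b h =>
      obtain ⟨h, rfl⟩ := h
      simp [col, h, ht]
    | refl => rfl
    | symm _ _ _ h => exact h.symm
    | trans _ _ _ _ _ h1 h2 => exact h1.trans h2
  have hrel : ∀ a, s a (col U t ht a).1 := by
    intro a
    by_cases h : a ∈ U
    · have : (col U t ht a).1 = t ⟨a, h⟩ := by simp [col, h]
      rw [this]
      exact Relation.EqvGen.rel _ _ ⟨h, rfl⟩
    · have : (col U t ht a).1 = a := by simp [col, h]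
      rw [this]
  let e : (G.contract U t).V ≃ {v // v ∉ U} :=
    { toFun := Quotient.lift (s := s) (col U t ht) hcol
      invFun := fun w => Quotient.mk s w.1
      left_inv := by
        intro q
        induction q using Quotient.inductionOn with
        | h a => exact (Quotient.sound (hrel a)).symm
      right_inv := by
        intro w
        show col U t ht w.1 = w
        simp [col, w.2] }
  have he : ∀ v, e (Quotient.mk s v) = col U t ht v := fun v => rfl
  unfold MGraph.pf
  refine Finset.sum_congr rfl fun κ _ => ?_
  refine Fintype.prod_equiv e _ _ fun v => ?_
  congr 1
  funext c
  refine Finset.sum_congr rfl fun a _ => ?_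
  have hh : ∀ x : G.V, ((Quotient.mk s x : (G.contract U t).V) = v) ↔ col U t ht x = e v := by
    intro x
    rw [← he]
    exact e.injective.eq_iff.symm
  have h1 : ∀ a, (G.contract U t).ends a =
    (Quotient.mk s (G.ends a).1, Quotient.mk s (G.ends a).2) := fun a => rfl
  have h2 : (G.contract U t).inc v a = (mapV G (col U t ht)).inc (e v) a := by
    unfold MGraph.inc
    congr 1
    · have := hh (G.ends a).1
      by_cases h : col U t ht (G.ends a).1 = e v
      · exact (if_pos (this.2 h)).trans (if_pos h).symm
      · exact (if_neg (fun z => h (this.1 z))).trans (if_neg h).symm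
    · have := hh (G.ends a).2
      by_cases h : col U t ht (G.ends a).2 = e v
      · exact (if_pos (this.2 h)).trans (if_pos h).symm
      · exact (if_neg (fun z => h (this.1 z))).trans (if_neg h).symm
  rw [h2]

lemma sum_col (U : Finset V) (t : {v // v ∈ U} → V) (ht : ∀ u, t u ∉ U) {M : Type}
    [AddCommMonoid M] (d : V → M) (w : {v // v ∉ U}) :
    (∑ v, if col U t ht v = w then d v else 0) =
      d w.1 + ∑ u : {v // v ∈ U}, if t u = w.1 then d u.1 else 0 := by
  rw [← Fintype.sum_subtype_add_sum_subtype (fun v => v ∈ U), add_comm]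
  congr 1
  · rw [Finset.sum_eq_single w]
    · simp [col, w.2]
    · intro b _ hb
      rw [if_neg]
      simpa [col, b.2] using hb
    · simp
  · refine Finset.sum_congr (by ext; simp) fun u _ => ?_
    have : (col U t ht u.1 = w) ↔ t u = w.1 := by
      simp [col, Subtype.ext_iff]
    simp only [this]

lemma sum_perm {A : Type} [CommRing A] (y : (Fin k → ℕ) → A) (d : V → Fin k → ℕ)
    (U : Finset V) (s : {v // v ∈ U} → V) (hs : ∀ u, s u ∉ U) (hinj : Function.Injective s) :
    ∑ π : Equiv.Perm {v // v ∈ U}, ((Equiv.Perm.sign π : ℤ) : A) *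
      ∏ w, y (∑ v, if col U (s ∘ π) (fun u => hs _) v = w then d v else 0) =
    (Matrix.of fun x u : {v // v ∈ U} => y (d (s x) + d u.1)).det *
      ∏ w ∈ (Finset.univ.image (fun u => (⟨s u, hs u⟩ : {v // v ∉ U})))ᶜ, y (d w.1) := by
  rw [Matrix.det_apply', Finset.sum_mul]
  refine Finset.sum_congr rfl fun π _ => ?_
  rw [mul_assoc]
  congr 1
  have him : Finset.univ.image (fun u => (⟨s u, hs u⟩ : {v // v ∉ U})) =
      Finset.univ.image (fun u => (⟨s (π u), hs (π u)⟩ : {v // v ∉ U})) := by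
    ext w
    simp only [Finset.mem_image, Finset.mem_univ, true_and]
    constructor
    · rintro ⟨u, rfl⟩; exact ⟨π.symm u, by simp⟩
    · rintro ⟨u, rfl⟩; exact ⟨π u, rfl⟩
  rw [him, ← Finset.prod_mul_prod_compl
    (Finset.univ.image (fun u => (⟨s (π u), hs (π u)⟩ : {v // v ∉ U})))]
  congr 1
  · rw [Finset.prod_image]
    · refine Finset.prod_congr rfl fun u _ => ?_
      rw [sum_col]
      simp [hinj.eq_iff]
    · intro a _ b _ h
      simpa [hinj.eq_iff] using h
  · refine Finset.prod_congr rfl fun w hw => ?_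
    rw [sum_col, Finset.sum_eq_zero, add_zero]
    intro u _
    rw [if_neg]
    intro h
    simp only [Finset.mem_compl, Finset.mem_image, Finset.mem_univ, true_and, not_exists] at hw
    exact hw u (Subtype.ext h)

lemma forward {F : Type} [Field F] [CharZero F] (r : ℕ) (y : (Fin k → ℕ) → F)
    (hy : ∀ α β : Fin (r + 1) → (Fin k → ℕ), (Matrix.of fun i j => y (α i + β j)).det = 0)
    (G : MGraph) (U : Finset G.V) (hU : U.card = r + 1)
    (s : {v // v ∈ U} → G.V) (hs : ∀ u, s u ∉ U) :
    ∑ π : Equiv.Perm {v // v ∈ U},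
      ((Equiv.Perm.sign π : ℤ) : F) * MGraph.pf k y (G.contract U (s ∘ π)) = 0 := by
  by_cases hinj : Function.Injective s
  · have h1 : ∀ π : Equiv.Perm {v // v ∈ U}, MGraph.pf k y (G.contract U (s ∘ π)) = _ :=
      fun π => (pf_contract G U (s ∘ π) (fun u => hs _) y).trans (pf_mapV _ _ _)
    simp only [h1, Finset.mul_sum]
    rw [Finset.sum_comm]
    refine Finset.sum_eq_zero fun κ _ => ?_
    rw [sum_perm y (G.degVec κ) U s hs hinj]
    have e : Fin (r + 1) ≃ {v // v ∈ U} := Fintype.equivOfCardEq (by simp [hU])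
    rw [← Matrix.det_submatrix_equiv_self e]
    have := hy (fun i => G.degVec κ (s (e i))) (fun i => G.degVec κ (e i))
    exact mul_eq_zero_of_left this _
  · simp only [Function.Injective, not_forall] at hinj
    obtain ⟨a, b, hab, hne⟩ := hinj
    rw [← self_eq_neg]
    conv_lhs => rw [← Equiv.sum_comp (Equiv.mulLeft (Equiv.swap a b))]
    rw [← Finset.sum_neg_distrib]
    refine Finset.sum_congr rfl fun π _ => ?_
    have : s ∘ (Equiv.mulLeft (Equiv.swap a b) π) = s ∘ π := by
      funext x
      simp only [Function.comp, Equiv.coe_mulLeft, Equiv.Perm.mul_apply]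
      by_cases h1 : π x = a
      · rw [h1, Equiv.swap_apply_left, hab]
      by_cases h2 : π x = b
      · rw [h2, Equiv.swap_apply_right, hab]
      rw [Equiv.swap_apply_of_ne_of_ne h1 h2]
    rw [this]
    simp [Equiv.Perm.sign_swap hne]

open MvPolynomial in
lemma Ph_det {F : Type} [Field F] [CharZero F] (r : ℕ) (y₀ : (Fin k → ℕ) → F)
    (hf : ∀ (G : MGraph) (U : Finset G.V), U.card = r + 1 →
        ∀ s : {v // v ∈ U} → G.V, (∀ u, s u ∉ U) →
          ∑ π : Equiv.Perm {v // v ∈ U},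
            ((Equiv.Perm.sign π : ℤ) : F) * MGraph.pf k y₀ (G.contract U (s ∘ π)) = 0)
    (d : V → Fin k → ℕ) (U : Finset V) (hU : U.card = r + 1)
    (s : {v // v ∈ U} → V) (hs : ∀ u, s u ∉ U) :
    Ph y₀ (∑ π : Equiv.Perm {v // v ∈ U}, ((Equiv.Perm.sign π : ℤ) : MvPolynomial (Fin k → ℕ) F) *
      ∏ w, X (∑ v, if col U (s ∘ π) (fun u => hs _) v = w then d v else 0)) = 0 := by
  let H := Σ v, Σ c, Fin (d v c)
  let vtx : H → V := Sigma.fst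
  let i : H → Fin k := fun h => h.2.1
  have hd : ∀ v, degJ vtx i v = d v := by
    intro v
    funext c
    have : degJ vtx i v c = ∑ v', ∑ c', ∑ x : Fin (d v' c'),
        if v' = v then (if c' = c then 1 else 0) else 0 := by
      simp only [degJ, H, Fintype.sum_sigma]
      rfl
    rw [this, Finset.sum_eq_single v, Finset.sum_eq_single c] <;> simp +contextual
  obtain ⟨c, hc⟩ := P_expand i
  choose Ed i1 i2 e he using fun N : Mat H => exists_edges N
  have h1 : ∀ π : Equiv.Perm {v // v ∈ U},
      Ph y₀ (∏ w, X (∑ v, if col U (s ∘ π) (fun u => hs _) v = w then d v else 0)) =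
      ∑ N, (c N : F) * MGraph.pf k y₀
        (@MGraph.contract (@sgraph H V _ _ (Ed N) (i1 N) (i2 N) vtx (e N)) U (s ∘ π)) := by
    intro π
    have h2 := Ph_prod y₀ (col U (s ∘ π) (fun u => hs _) ∘ vtx) i
    simp only [degJ_map vtx (col U (s ∘ π) (fun u => hs _)) i, hd] at h2
    rw [h2]
    simp only [hc, Rat.cast_sum, Rat.cast_mul, Finset.sum_mul]
    rw [Finset.sum_comm]
    refine Finset.sum_congr rfl fun N _ => ?_
    letI := i1 N
    letI := i2 N
    rw [pf_contract (sgraph vtx (e N)) U (s ∘ π) (fun u => hs _)]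
    have h3 := pf_sgraph (F := F) (col U (s ∘ π) (fun u => hs _) ∘ vtx) (e N) N (he N) y₀
    simp only [mul_assoc]
    rw [← Finset.mul_sum]
    congr 1
    exact h3.symm
  have h4 : ∀ π : Equiv.Perm {v // v ∈ U}, ((Equiv.Perm.sign π : ℤ) : MvPolynomial (Fin k → ℕ) F) =
    C ((Equiv.Perm.sign π : ℤ) : F) := fun π => (map_intCast (C : F →+* MvPolynomial (Fin k → ℕ) F) _).symm
  simp only [map_sum, h4, ← smul_eq_C_mul, map_smul, h1, smul_eq_mul, Finset.mul_sum]
  rw [Finset.sum_comm]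
  refine Finset.sum_eq_zero fun N _ => ?_
  have h5 := hf (@sgraph H V _ _ (Ed N) (i1 N) (i2 N) vtx (e N)) U hU s hs
  simp only [mul_left_comm _ (c N : F)]
  rw [← Finset.mul_sum]
  exact mul_eq_zero_of_right _ h5

open MvPolynomial in
lemma Ph_minor {F : Type} [Field F] [CharZero F] (r : ℕ) (y₀ : (Fin k → ℕ) → F)
    (hf : ∀ (G : MGraph) (U : Finset G.V), U.card = r + 1 →
        ∀ s : {v // v ∈ U} → G.V, (∀ u, s u ∉ U) →
          ∑ π : Equiv.Perm {v // v ∈ U},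
            ((Equiv.Perm.sign π : ℤ) : F) * MGraph.pf k y₀ (G.contract U (s ∘ π)) = 0)
    (α β : Fin (r + 1) → (Fin k → ℕ)) (T : MvPolynomial (Fin k → ℕ) F) :
    Ph y₀ (T * (Matrix.of fun i j => (X (α i + β j) : MvPolynomial (Fin k → ℕ) F)).det) = 0 := by
  have key := lin_zero ((Ph y₀).comp (LinearMap.mulRight F
    (Matrix.of fun i j => (X (α i + β j) : MvPolynomial (Fin k → ℕ) F)).det)) ?_ T
  · simpa only [LinearMap.comp_apply, LinearMap.mulRight_apply] using key
  intro W _ _ γ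
  simp only [LinearMap.comp_apply, LinearMap.mulRight_apply]
  let V := (Fin (r + 1) ⊕ Fin (r + 1)) ⊕ W
  let d : V → Fin k → ℕ := Sum.elim (Sum.elim β α) γ
  let emb : Fin (r + 1) ↪ V := ⟨fun x => Sum.inl (Sum.inl x), fun a b h => Sum.inl_injective (Sum.inl_injective h)⟩
  let U : Finset V := Finset.univ.map emb
  have hmem : ∀ v : V, v ∈ U ↔ ∃ x, Sum.inl (Sum.inl x) = v := by
    intro v
    simp only [U, Finset.mem_map, Finset.mem_univ, true_and]
    rfl
  let eU : Fin (r + 1) ≃ {v // v ∈ U} := Equiv.ofBijective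
    (fun x => ⟨Sum.inl (Sum.inl x), (hmem _).2 ⟨x, rfl⟩⟩) ⟨fun a b h => Sum.inl_injective (Sum.inl_injective (Subtype.ext_iff.1 h)), by
      rintro ⟨v, hv⟩
      obtain ⟨x, rfl⟩ := (hmem v).1 hv
      exact ⟨x, rfl⟩⟩
  let s : {v // v ∈ U} → V := fun u => Sum.inl (Sum.inr (eU.symm u))
  have hs : ∀ u, s u ∉ U := by
    intro u h
    obtain ⟨x, hx⟩ := (hmem _).1 h
    simp [s] at hx
  have hinj : Function.Injective s := by
    intro a b h
    exact eU.symm.injective (Sum.inr_injective (Sum.inl_injective h))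
  have h1 := Ph_det r y₀ hf d U (by simp [U]) s hs
  rw [sum_perm X d U s hs hinj] at h1
  rw [mul_comm]
  convert h1 using 3
  · rw [← Matrix.det_submatrix_equiv_self eU]
    congr 1
    refine Matrix.ext fun a b => ?_
    have : s (eU a) = Sum.inl (Sum.inr a) := by simp [s]
    show X (α a + β b) = X (d (s (eU a)) + d (eU b).1)
    rw [this]
    rfl
  · have hW : ∀ w : W, (Sum.inr w : V) ∉ U := by
      intro w h
      obtain ⟨x, hx⟩ := (hmem _).1 h
      simp at hx
    refine Finset.prod_bij (fun w _ => (⟨Sum.inr w, hW w⟩ : {v // v ∉ U})) ?_ ?_ ?_ ?_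
    · intro w _
      simp [s]
    · intro a _ b _ h
      exact Sum.inr_injective (Subtype.ext_iff.1 h)
    · rintro ⟨((x | x) | w), hx⟩ hw
      · exact absurd ((hmem _).2 ⟨x, rfl⟩) hx
      · simp only [Finset.mem_compl, Finset.mem_image, Finset.mem_univ, true_and,
          not_exists] at hw
        exact absurd (Subtype.ext (by simp [s])) (hw (eU x))
      · exact ⟨w, Finset.mem_univ _, rfl⟩
    · intro w _
      rfl

end Contract

section Descent

lemma fin_rank {K : Type} [Field K] (k r : ℕ) (y : (Fin k → ℕ) → K)
    (hy : ∀ α β : Fin (r + 1) → (Fin k → ℕ), (Matrix.of fun i j => y (α i + β j)).det = 0) :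
    ∃ (m : ℕ) (α : Fin m → (Fin k → ℕ)), ∀ γ, ∃ c : Fin m → K,
      ∀ δ, y (γ + δ) = ∑ j, c j * y (α j + δ) := by
  let Q : ℕ → Prop := fun m => ∃ α β : Fin m → (Fin k → ℕ),
    (Matrix.of fun i j => y (α i + β j)).det ≠ 0
  have hm : ∃ m, Q m ∧ ¬ Q (m + 1) := by
    by_contra! h
    have : ∀ m, Q m := by
      intro m
      induction m with
      | zero => exact ⟨Fin.elim0, Fin.elim0, by simp⟩
      | succ m ih => exact h m ih
    obtain ⟨α, β, h'⟩ := this (r + 1)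
    exact h' (hy α β)
  obtain ⟨m, ⟨α, β, hA⟩, hmax⟩ := hm
  refine ⟨m, α, fun γ => ?_⟩
  set A : Matrix (Fin m) (Fin m) K := Matrix.of fun i j => y (α i + β j) with hAdef
  let R : Matrix Unit (Fin m) K := Matrix.of fun _ j => y (γ + β j)
  refine ⟨fun j => (R * A⁻¹) () j, fun δ => ?_⟩
  let Cc : Matrix (Fin m) Unit K := Matrix.of fun i _ => y (α i + δ)
  let D : Matrix Unit Unit K := Matrix.of fun _ _ => y (γ + δ)
  have hdet : (Matrix.fromBlocks A Cc R D).det = 0 := by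
    by_contra hne
    apply hmax
    let e : Fin (m + 1) ≃ Fin m ⊕ Unit := Fintype.equivOfCardEq (by simp)
    refine ⟨(Sum.elim α (fun _ => γ)) ∘ e, (Sum.elim β (fun _ => δ)) ∘ e, ?_⟩
    rw [← Matrix.det_submatrix_equiv_self e] at hne
    convert hne using 2
    ext a b
    simp only [Matrix.of_apply, Matrix.submatrix_apply, Function.comp]
    rcases e a with a | a <;> rcases e b with b | b <;> rfl
  have hU : IsUnit A.det := isUnit_iff_ne_zero.2 hA
  letI : Invertible A := Matrix.invertibleOfIsUnitDet A hU
  rw [Matrix.det_fromBlocks₁₁, mul_eq_zero] at hdet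
  have h2 := hdet.resolve_left hA
  rw [Matrix.det_unique, Matrix.sub_apply, sub_eq_zero, Matrix.invOf_eq_nonsing_inv,
    Matrix.mul_apply] at h2
  exact h2

lemma adjoin_fin {F K : Type} [Field F] [Field K] [Algebra F K] (k r : ℕ) (y : (Fin k → ℕ) → K)
    (hy : ∀ α β : Fin (r + 1) → (Fin k → ℕ), (Matrix.of fun i j => y (α i + β j)).det = 0) :
    ∃ S : Set K, S.Finite ∧ ∀ γ, y γ ∈ Algebra.adjoin F S := by
  obtain ⟨m, α, h⟩ := fin_rank k r y hy
  choose c hc using h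
  let S : Set K := Set.range (c 0) ∪ Set.range (fun p : Fin k × Fin m × Fin m =>
    c (α p.2.1 + Pi.single p.1 1) p.2.2) ∪ Set.range (fun j => y (α j))
  refine ⟨S, ((Set.finite_range _).union (Set.finite_range _)).union (Set.finite_range _), ?_⟩
  have hS : ∀ x ∈ S, x ∈ Algebra.adjoin F S := fun x hx => Algebra.subset_adjoin hx
  have key : ∀ (n : ℕ) (γ : Fin k → ℕ), ∑ l, γ l = n → ∃ b : Fin m → K,
      (∀ j, b j ∈ Algebra.adjoin F S) ∧ ∀ δ, y (γ + δ) = ∑ j, b j * y (α j + δ) := by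
    intro n
    induction n with
    | zero =>
      intro γ hγ
      have : γ = 0 := by
        funext l
        simpa using (Finset.sum_eq_zero_iff.1 hγ) l (Finset.mem_univ _)
      subst this
      exact ⟨c 0, fun j => hS _ (Or.inl (Or.inl ⟨j, rfl⟩)), hc 0⟩
    | succ n ih =>
      intro γ hγ
      obtain ⟨l, hl⟩ : ∃ l, γ l ≠ 0 := by
        by_contra! h
        simp [h] at hγ
      obtain ⟨γ', rfl⟩ : ∃ γ' : Fin k → ℕ, γ = γ' + (Pi.single l 1 : Fin k → ℕ) := by
        refine ⟨γ - Pi.single l 1, ?_⟩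
        funext x
        show γ x = (γ x - (Pi.single l 1 : Fin k → ℕ) x) + (Pi.single l 1 : Fin k → ℕ) x
        by_cases hx : x = l
        · subst hx; simp only [Pi.single_eq_same]; omega
        · simp [hx]
      have hγ' : ∑ l, γ' l = n := by
        simp [Finset.sum_add_distrib] at hγ
        exact hγ
      obtain ⟨b, hb, hb'⟩ := ih γ' hγ'
      refine ⟨fun j => ∑ i, b i * c (α i + Pi.single l 1) j, fun j => ?_, fun δ => ?_⟩
      · exact Subalgebra.sum_mem _ fun i _ => Subalgebra.mul_mem _ (hb i)
          (hS _ (Or.inl (Or.inr ⟨(l, i, j), rfl⟩)))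
      · rw [add_assoc, hb']
        simp only [← add_assoc, hc (α _ + Pi.single l 1), Finset.sum_mul, Finset.mul_sum, mul_assoc]
        rw [Finset.sum_comm]
  intro γ
  obtain ⟨b, hb, hb'⟩ := key _ γ rfl
  have := hb' 0
  simp only [add_zero] at this
  rw [this]
  exact Subalgebra.sum_mem _ fun i _ => Subalgebra.mul_mem _ (hb i) (hS _ (Or.inr ⟨i, rfl⟩))

lemma exists_hom {F : Type} [Field F] [IsAlgClosed F] (T : Type) [CommRing T] [Nontrivial T]
    [Algebra F T] [Algebra.FiniteType F T] : Nonempty (T →ₐ[F] F) := by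
  obtain ⟨M, hM⟩ := Ideal.exists_maximal T
  letI := Ideal.Quotient.field M
  haveI : Algebra.FiniteType F (T ⧸ M) := Algebra.FiniteType.of_surjective
    (Ideal.Quotient.mkₐ F M) (Ideal.Quotient.mkₐ_surjective F M)
  haveI : Module.Finite F (T ⧸ M) := finite_of_finite_type_of_isJacobsonRing F (T ⧸ M)
  exact ⟨(IsAlgClosed.lift : (T ⧸ M) →ₐ[F] F).comp (Ideal.Quotient.mkₐ F M)⟩

lemma det_map {A A' : Type} [CommRing A] [CommRing A'] (ψ : A →+* A') {n k : ℕ}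
    (y : (Fin k → ℕ) → A) (α β : Fin n → (Fin k → ℕ)) :
    (Matrix.of fun i j => ψ (y (α i + β j))).det = ψ (Matrix.of fun i j => y (α i + β j)).det := by
  rw [RingHom.map_det]
  rfl

open MvPolynomial in
lemma backward {F : Type} [Field F] [IsAlgClosed F] [CharZero F] (k r : ℕ)
    (y₀ : (Fin k → ℕ) → F)
    (hf : ∀ (G : MGraph) (U : Finset G.V), U.card = r + 1 →
        ∀ s : {v // v ∈ U} → G.V, (∀ u, s u ∉ U) →
          ∑ π : Equiv.Perm {v // v ∈ U},
            ((Equiv.Perm.sign π : ℤ) : F) * MGraph.pf k y₀ (G.contract U (s ∘ π)) = 0) :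
    ∃ y : (Fin k → ℕ) → F,
        (∀ α β : Fin (r + 1) → (Fin k → ℕ),
          (Matrix.of fun i j => y (α i + β j)).det = 0) ∧
        ∀ G : MGraph, MGraph.pf k y₀ G = MGraph.pf k y G := by
  let S : Set (MvPolynomial (Fin k → ℕ) F) :=
    {x | ∃ α β : Fin (r + 1) → (Fin k → ℕ), x = (Matrix.of fun i j => X (α i + β j)).det} ∪
    {x | ∃ G : MGraph, x = MGraph.pf k X G - C (MGraph.pf k y₀ G)}
  let J : Ideal (MvPolynomial (Fin k → ℕ) F) := Ideal.span S
  have hJ : ∀ x ∈ J, ∀ T, Ph y₀ (T * x) = 0 := by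
    intro x hx
    induction hx using Submodule.span_induction with
    | mem x h =>
      rcases h with ⟨α, β, rfl⟩ | ⟨G, rfl⟩
      · exact Ph_minor r y₀ hf α β
      · exact Ph_graph y₀ G
    | zero => simp
    | add x y _ _ h1 h2 => intro T; rw [mul_add, map_add, h1, h2, add_zero]
    | smul a x _ h => intro T; rw [smul_eq_mul, ← mul_assoc, h]
  have hne : J ≠ ⊤ := by
    intro h
    have := hJ 1 ((Ideal.eq_top_iff_one J).1 h) 1
    rw [mul_one, Ph_one] at this
    exact one_ne_zero this
  obtain ⟨M, hM, hJM⟩ := Ideal.exists_le_maximal J hne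
  letI := Ideal.Quotient.field M
  let yK : (Fin k → ℕ) → (MvPolynomial (Fin k → ℕ) F ⧸ M) := fun α => Ideal.Quotient.mk M (X α)
  have hy1 : ∀ α β : Fin (r + 1) → (Fin k → ℕ),
      (Matrix.of fun i j => yK (α i + β j)).det = 0 := by
    intro α β
    rw [det_map (Ideal.Quotient.mk M) X, Ideal.Quotient.eq_zero_iff_mem]
    exact hJM (Ideal.subset_span (Or.inl ⟨α, β, rfl⟩))
  have hy2 : ∀ G, MGraph.pf k yK G = algebraMap F _ (MGraph.pf k y₀ G) := by
    intro G
    rw [← pf_map (Ideal.Quotient.mk M) X]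
    exact Ideal.Quotient.eq.2 (hJM (Ideal.subset_span (Or.inr ⟨G, rfl⟩)))
  obtain ⟨S', hS', hmem⟩ := adjoin_fin (F := F) k r yK hy1
  let T := Algebra.adjoin F S'
  haveI : Algebra.FiniteType F T :=
    (Subalgebra.fg_iff_finiteType _).1 (Subalgebra.fg_def.2 ⟨S', hS', rfl⟩)
  obtain ⟨ψ⟩ := exists_hom (F := F) T
  let yT : (Fin k → ℕ) → T := fun α => ⟨yK α, hmem α⟩
  have hinj : Function.Injective (T.val : T →+* (MvPolynomial (Fin k → ℕ) F ⧸ M)) :=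
    Subtype.val_injective
  refine ⟨fun α => ψ (yT α), fun α β => ?_, fun G => ?_⟩
  · show (Matrix.of fun i j => (ψ : T →+* F) (yT (α i + β j))).det = 0
    rw [det_map (ψ : T →+* F) yT]
    have : (Matrix.of fun i j => yT (α i + β j)).det = 0 := by
      apply hinj
      rw [← det_map, map_zero]
      exact hy1 α β
    rw [this, map_zero]
  · show _ = MGraph.pf k (fun α => (ψ : T →+* F) (yT α)) G
    rw [← pf_map (ψ : T →+* F) yT]
    have : MGraph.pf k yT G = algebraMap F T (MGraph.pf k y₀ G) := by
      apply hinj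
      rw [pf_map]
      exact hy2 G
    rw [this]
    simp

end Descent

end PFR

/-- Theorem 2 of the paper: if `f` is the partition function of a
`k`-color vertex model over an algebraically closed field of characteristic 0, then
`f` is the partition function of a `k`-color vertex model whose moment matrix has
rank at most `r` (all `(r+1) × (r+1)` minors vanish) if and only if the signed
contraction condition holds for sets of `r+1` vertices and maps `s : U → V \ U`. -/
theorem pf_finite_rank_characterization {F : Type} [Field F] [IsAlgClosed F] [CharZero F]
    (k r : ℕ) (f : MGraph → F)
    (hpf : ∃ y₀ : (Fin k → ℕ) → F, ∀ G : MGraph, f G = MGraph.pf k y₀ G) :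
    (∃ y : (Fin k → ℕ) → F,
        (∀ α β : Fin (r + 1) → (Fin k → ℕ),
          (Matrix.of fun i j => y (α i + β j)).det = 0) ∧
        ∀ G : MGraph, f G = MGraph.pf k y G) ↔
      (∀ (G : MGraph) (U : Finset G.V), U.card = r + 1 →
        ∀ s : {v // v ∈ U} → G.V, (∀ u, s u ∉ U) →
          ∑ π : Equiv.Perm {v // v ∈ U},
            ((Equiv.Perm.sign π : ℤ) : F) * f (G.contract U (s ∘ π)) = 0) := by
  obtain ⟨y₀, hy₀⟩ := hpf
  obtain rfl : f = MGraph.pf k y₀ := funext hy₀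
  constructor
  · rintro ⟨y, hy, h⟩ G U hU s hs
    simp only [h]
    exact PFR.forward r y hy G U hU s hs
  · exact PFR.backward k r y₀
end

section
/- Let F be an algebraically closed field of characteristic 0, and let 𝓙 ⊆ R = F[y_α : α ∈ N^k] be the ideal generated by all (r+1)×(r+1) minors det(y_{α_i+β_j})_{i,j=1}^{r+1} of the moment matrix. Let J ⊆ FG be the span of the quantum graphs Σ_{π∈S_U} sgn(π) G/(s∘π) over all graphs G, U ⊆ V(G) with |U| = r+1, and s : U → V(G)\U. Then ρ_{O_k}(𝓙) ⊆ p(J), where p : FG → R is the partition-function map and ρ_{O_k} the Reynolds operator for the O_k-action on R. -/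
set_option linter.unusedVariables false

open MvPolynomial

/-- the polynomial ring `R = F[y_α : α ∈ ℕ^k]`. -/
abbrev PolyR (F : Type) [CommRing F] (k : ℕ) : Type := MvPolynomial (Fin k → ℕ) F

/-- the partition function of `G` as a polynomial in the variables `y_α`, i.e.
`p(G)(y) = f_y(G)`. -/
noncomputable def pPoly (F : Type) [CommRing F] (k : ℕ) (G : MGraph) : PolyR F k :=
  ∑ κ : G.E → Fin k, ∏ v : G.V, X (G.degVec κ v)

/-- the linear extension of `p` to formal linear combinations of graphs. -/
noncomputable def pLin (F : Type) [CommRing F] (k : ℕ) : (MGraph →₀ F) →ₗ[F] PolyR F k :=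
  Finsupp.linearCombination F (pPoly F k)

/-- the substitution action of a matrix `g` on `F[x_1,…,x_k]` : `x_i ↦ ∑_j g_{j i} x_j`. -/
noncomputable def substAct {F : Type} [CommRing F] {k : ℕ}
    (g : Matrix (Fin k) (Fin k) F) :
    MvPolynomial (Fin k) F →ₐ[F] MvPolynomial (Fin k) F :=
  aeval (fun i => ∑ j, C (g j i) * X j)

/-- the linear map `F[x_1,…,x_k] → R` sending the monomial `x^α` to the variable `y_α`. -/
noncomputable def monToVar (F : Type) [CommRing F] (k : ℕ)
    (q : MvPolynomial (Fin k) F) : PolyR F k :=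
  ∑ d ∈ q.support, C (q.coeff d) * X (⇑d : Fin k → ℕ)

/-- the action of a matrix `g` on `R = F[y_α]` induced from the substitution action on
`F[x_1,…,x_k]` via the identification `y_α ↔ x^α`. -/
noncomputable def gAct {F : Type} [CommRing F] {k : ℕ}
    (g : Matrix (Fin k) (Fin k) F) : PolyR F k →ₐ[F] PolyR F k :=
  aeval (fun α : Fin k → ℕ => monToVar F k (substAct g (∏ i, X i ^ α i)))

/-- `O_k`-invariance of an element of `R`. -/
def OkInvariant {F : Type} [CommRing F] {k : ℕ} (q : PolyR F k) : Prop :=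
  ∀ g : Matrix (Fin k) (Fin k) F, g.transpose * g = 1 → gAct g q = q

/-- `τ : O(Sym F^{n×n}) → O(F^{k×n})`, `τ(q)(z) = q(zᵀz)` : the algebra map sending the
coordinate `x_{ij}` to `∑_h z_{h,i} z_{h,j}`. -/
noncomputable def tauMap (F : Type) [CommRing F] (k n : ℕ) :
    MvPolynomial (Sym2 (Fin n)) F →ₐ[F] MvPolynomial (Fin k × Fin n) F :=
  aeval (fun s => Sym2.lift
    ⟨fun i j => ∑ h : Fin k, X (h, i) * X (h, j),
      fun i j => Finset.sum_congr rfl (fun h _ => mul_comm _ _)⟩ s)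

/-- the multigraph on vertex set `[n]` whose edge multiset is given by the exponent
vector `d` of a monomial in the variables `x_{ij}`. -/
noncomputable def graphOf (n : ℕ) (d : Sym2 (Fin n) →₀ ℕ) : MGraph where
  V := Fin n
  E := (s : Sym2 (Fin n)) × Fin (d s)
  ends := fun e => (Quot.out e.1 : Fin n × Fin n)


section CoreQ
open Finset

def InvQ {ι : Type} [Fintype ι] [DecidableEq ι] {k : ℕ} (f : (ι → Fin k) → ℚ) : Prop :=
  ∀ g : Matrix (Fin k) (Fin k) ℚ, g.transpose * g = 1 →
    ∀ c, ∑ c' : ι → Fin k, (∏ i, g (c' i) (c i)) * f c' = f c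

variable {ι : Type} [Fintype ι] [DecidableEq ι] {k : ℕ}

theorem prod_one_apply_q {S : Type} [CommRing S] (s : Finset ι) (c c' : ι → Fin k) :
    (∏ i ∈ s, (1 : Matrix (Fin k) (Fin k) S) (c' i) (c i)) = if ∀ i ∈ s, c' i = c i then 1 else 0 := by
  simp only [Matrix.one_apply]
  rw [Finset.prod_ite_zero]
  simp

theorem parity_q (f : (ι → Fin k) → ℚ) (hf : InvQ f) (c : ι → Fin k) (a : Fin k)
    (hodd : Odd (#{i | c i = a})) : f c = 0 := by
  have h := hf (Matrix.diagonal (fun x => if x = a then -1 else 1)) (by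
    rw [Matrix.diagonal_transpose, Matrix.diagonal_mul_diagonal, ← Matrix.diagonal_one]
    congr 1; ext x; split_ifs <;> simp) c
  rw [Finset.sum_eq_single c] at h
  · simp only [Matrix.diagonal_apply_eq] at h
    rw [Finset.prod_ite] at h
    simp only [prod_const, one_pow, mul_one, hodd.neg_one_pow] at h
    linarith
  · intro c' _ hne
    obtain ⟨i, hi⟩ := Function.ne_iff.mp hne
    rw [Finset.prod_eq_zero (mem_univ i), zero_mul]
    exact Matrix.diagonal_apply_ne _ hi
  · simp

theorem sum_update_q (c : ι → Fin k) (i : ι) (B : Fin k → ℚ) (f : (ι → Fin k) → ℚ) :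
    ∑ c' : ι → Fin k, (∏ j ∈ univ.erase i, (1 : Matrix (Fin k) (Fin k) ℚ) (c' j) (c j)) * B (c' i) * f c'
      = ∑ d, B d * f (Function.update c i d) := by
  symm
  apply Finset.sum_of_injOn (fun d => Function.update c i d)
  · intro d _ d' _ h
    have := congrFun h i
    simpa using this
  · simp
  · intro c' _ hc'
    rw [prod_one_apply_q, if_neg, zero_mul, zero_mul]
    intro hall
    apply hc'
    refine ⟨c' i, by simp, ?_⟩
    ext j
    by_cases hj : j = i
    · subst hj; simp
    · simp [Function.update_of_ne hj, hall j (by simp [hj])]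
  · intro d _
    rw [prod_one_apply_q, if_pos, one_mul]
    · simp
    · intro j hj
      simp at hj
      simp [Function.update_of_ne hj]

theorem rot_orth (a b : Fin k) (hab : a ≠ b) (t : ℚ) :
    let P : Matrix (Fin k) (Fin k) ℚ := Matrix.single a a 1 + Matrix.single b b 1
    let A : Matrix (Fin k) (Fin k) ℚ := Matrix.single a b 1 - Matrix.single b a 1
    let g := (1 : Matrix (Fin k) (Fin k) ℚ) - (2 * t^2 / (1 + t^2)) • P + (2 * t / (1 + t^2)) • A
    g.transpose * g = 1 := by
  intro P A g
  have hPP : P * P = P := by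
    simp [P, add_mul, mul_add, Matrix.single_mul_single_of_ne, hab, hab.symm]
  have hPA : P * A = A := by
    simp [P, A, add_mul, mul_sub, Matrix.single_mul_single_of_ne, hab, hab.symm]
  have hAP : A * P = A := by
    simp [P, A, sub_mul, mul_add, Matrix.single_mul_single_of_ne, hab, hab.symm]
    abel
  have hAA : A * A = -P := by
    simp [P, A, sub_mul, mul_sub, Matrix.single_mul_single_of_ne, hab, hab.symm]
    abel
  have hPt : P.transpose = P := by simp [P]
  have hAt : A.transpose = -A := by simp [A]
  have ht : (1 + t^2) ≠ 0 := by positivity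
  simp only [g, Matrix.transpose_add, Matrix.transpose_sub, Matrix.transpose_smul, hPt, hAt,
    Matrix.transpose_one]
  generalize hx : 2 * t^2 / (1 + t^2) = x
  generalize hy : 2 * t / (1 + t^2) = y
  have hxy : -2 * x + x^2 + y^2 = 0 := by
    rw [← hx, ← hy]; field_simp; ring
  have : (1 - x • P + y • -A) * (1 - x • P + y • A) = 1 + (-2 * x + x^2 + y^2) • P := by
    simp only [add_mul, sub_mul, mul_add, mul_sub, one_mul, mul_one, Matrix.smul_mul, Matrix.mul_smul,
      hPP, hPA, hAP, hAA, neg_mul, smul_neg, neg_neg]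
    module
  rw [this, hxy]; simp

def Lop (f : (ι → Fin k) → ℚ) (a b : Fin k) (c : ι → Fin k) : ℚ :=
  ∑ i, if c i = a then f (Function.update c i b) else 0

theorem lie_q (f : (ι → Fin k) → ℚ) (hf : InvQ f) (a b : Fin k) (c : ι → Fin k) :
    Lop f a b c = Lop f b a c := by
  by_cases hab : a = b
  · rw [hab]
  have horth := rot_orth a b hab
  set P : Matrix (Fin k) (Fin k) ℚ := Matrix.single a a 1 + Matrix.single b b 1 with hP
  set A : Matrix (Fin k) (Fin k) ℚ := Matrix.single a b 1 - Matrix.single b a 1 with hA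
  let G : Fin k → Fin k → Polynomial ℚ := fun p q =>
    (1 + Polynomial.X^2) * Polynomial.C ((1 : Matrix (Fin k) (Fin k) ℚ) p q) - 2 * Polynomial.X^2 * Polynomial.C (P p q)
      + 2 * Polynomial.X * Polynomial.C (A p q)
  have key : ∑ c' : ι → Fin k, (∏ i, G (c' i) (c i)) * Polynomial.C (f c')
      = (1 + Polynomial.X^2)^(Fintype.card ι) * Polynomial.C (f c) := by
    apply Polynomial.funext
    intro t
    have ht : (1 + t^2) ≠ 0 := by positivity
    have h := hf _ (horth t) c
    simp only [Polynomial.eval_finsetSum, Polynomial.eval_mul, Polynomial.eval_prod, Polynomial.eval_C,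
      Polynomial.eval_pow, Polynomial.eval_add, Polynomial.eval_one, Polynomial.eval_X]
    rw [← h, Finset.mul_sum]
    refine Finset.sum_congr rfl fun c' _ => ?_
    rw [← mul_assoc]
    congr 1
    rw [← Finset.card_univ, ← Finset.prod_const, ← Finset.prod_mul_distrib]
    refine Finset.prod_congr rfl fun i _ => ?_
    simp only [G, Polynomial.eval_add, Polynomial.eval_sub, Polynomial.eval_mul, Polynomial.eval_C,
      Polynomial.eval_pow, Polynomial.eval_one, Polynomial.eval_X, Polynomial.eval_ofNat,
      Matrix.add_apply, Matrix.sub_apply (1 : Matrix (Fin k) (Fin k) ℚ), Matrix.smul_apply, smul_eq_mul]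
    field_simp
  have hd := congrArg (fun p => Polynomial.eval 0 (Polynomial.derivative p)) key
  have hG0 : ∀ p q, Polynomial.eval 0 (G p q) = (1 : Matrix (Fin k) (Fin k) ℚ) p q := by
    intro p q; simp [G]
  have hG1 : ∀ p q, Polynomial.eval 0 (Polynomial.derivative (G p q)) = 2 * A p q := by
    intro p q; simp [G, Polynomial.derivative_pow]
  simp only [Polynomial.derivative_sum, Polynomial.derivative_mul, Polynomial.derivative_prod_finset,
    Polynomial.derivative_C, Polynomial.eval_finsetSum, Polynomial.eval_mul, Polynomial.eval_add,
    Polynomial.eval_prod, Polynomial.eval_C, hG0, hG1, mul_zero, Polynomial.eval_zero, add_zero] at hd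
  have hR : Polynomial.eval 0 (Polynomial.derivative ((1 + Polynomial.X^2 : Polynomial ℚ)^(Fintype.card ι))) = 0 := by
    simp [Polynomial.derivative_pow]
  rw [hR, zero_mul] at hd
  simp only [Finset.sum_mul] at hd
  rw [Finset.sum_comm] at hd
  have h2 : ∀ i, ∑ c' : ι → Fin k, (∏ j ∈ univ.erase i, (1 : Matrix (Fin k) (Fin k) ℚ) (c' j) (c j)) * (2 * A (c' i) (c i)) * f c'
      = 2 * ((if c i = b then f (Function.update c i a) else 0) - (if c i = a then f (Function.update c i b) else 0)) := by
    intro i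
    rw [sum_update_q c i (fun d => 2 * A d (c i)) f]
    have : ∀ d, 2 * A d (c i) * f (Function.update c i d) = 2 * ((if a = d then (if c i = b then f (Function.update c i d) else 0) else 0)
        - (if b = d then (if c i = a then f (Function.update c i d) else 0) else 0)) := by
      intro d
      simp only [A, Matrix.sub_apply, Matrix.single_apply]
      by_cases h1 : a = d <;> by_cases h2 : b = d <;> by_cases h3 : b = c i <;> by_cases h4 : a = c i <;>
        simp [h1, h2, h3, h4, eq_comm] <;> simp_all
    simp only [this, ← Finset.mul_sum, Finset.sum_sub_distrib, Finset.sum_ite_eq, mem_univ, if_true]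
  simp only [h2, ← Finset.mul_sum, Finset.sum_sub_distrib] at hd
  simp only [Lop]
  linarith

theorem sum_update_inv (F : (ι → Fin k) → ℚ) (i : ι) :
    ∑ c : ι → Fin k, ∑ a, F (Function.update c i a) = k * ∑ c, F c := by
  rw [← Fintype.sum_prod_type' (f := fun (c : ι → Fin k) (a : Fin k) => F (Function.update c i a))]
  have hinv : Function.Involutive (fun x : (ι → Fin k) × Fin k => (Function.update x.1 i x.2, x.1 i)) := by
    rintro ⟨c, a⟩; simp
  rw [← Equiv.sum_comp (hinv.toPerm)]
  simp only [Function.Involutive.coe_toPerm, Function.update_idem, Function.update_eq_self]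
  rw [Fintype.sum_prod_type' (f := fun (c : ι → Fin k) (a : Fin k) => F c)]
  simp [Finset.mul_sum]

theorem core_q [Nonempty ι] (f : (ι → Fin k) → ℚ) (hf : InvQ f)
    (hc : ∀ i j, i ≠ j → ∀ c, ∑ a, f (Function.update (Function.update c i a) j a) = 0) : f = 0 := by
  have hoff : ∀ i j, i ≠ j → ∑ c, f (Function.update c i (c j)) * f (Function.update c j (c i)) = 0 := by
    intro i j hij
    have h := sum_update_inv (fun c => f (Function.update c i (c j)) * f (Function.update c j (c i))) i
    simp only [Function.update_idem, Function.update_self, Function.update_of_ne hij.symm,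
      ← Finset.mul_sum, hc i j hij, mul_zero, Finset.sum_const_zero] at h
    rcases Nat.eq_zero_or_pos k with hk | hk
    · subst hk
      apply Finset.sum_eq_zero
      intro c; exact (c i).elim0
    · have : (k : ℚ) ≠ 0 := by positivity
      have h3 := h.symm
      rcases mul_eq_zero.mp h3 with h4 | h4
      · exact absurd h4 this
      · exact h4
  have main : ∑ a, ∑ b, ∑ c, Lop f a b c * Lop f b a c = (Fintype.card ι : ℚ) * ∑ c, f c * f c := by
    calc ∑ a, ∑ b, ∑ c, Lop f a b c * Lop f b a c
        = ∑ c, ∑ a, ∑ b, Lop f a b c * Lop f b a c := by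
          symm
          rw [Finset.sum_comm]
          refine Finset.sum_congr rfl fun a _ => ?_
          rw [Finset.sum_comm]
      _ = ∑ c : ι → Fin k, ∑ i, ∑ j, f (Function.update c i (c j)) * f (Function.update c j (c i)) := by
          refine Finset.sum_congr rfl fun c _ => ?_
          simp only [Lop, Finset.sum_mul_sum]
          have : ∀ a b, ∑ i, ∑ j, (if c i = a then f (Function.update c i b) else 0) * (if c j = b then f (Function.update c j a) else 0)
            = ∑ i, ∑ j, (if c i = a then (if c j = b then f (Function.update c i b) * f (Function.update c j a) else 0) else 0) := by
            intro a b
            refine Finset.sum_congr rfl fun i _ => Finset.sum_congr rfl fun j _ => ?_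
            split_ifs <;> simp
          simp only [this]
          simp_rw [Finset.sum_comm (s := (univ : Finset (Fin k))) (t := (univ : Finset ι))]
          refine Finset.sum_congr rfl fun i _ => Finset.sum_congr rfl fun j _ => ?_
          simp
      _ = ∑ i, ∑ j, ∑ c : ι → Fin k, f (Function.update c i (c j)) * f (Function.update c j (c i)) := by
          rw [Finset.sum_comm]
          refine Finset.sum_congr rfl fun i _ => ?_
          rw [Finset.sum_comm]
      _ = ∑ i : ι, ∑ c : ι → Fin k, f c * f c := by
          refine Finset.sum_congr rfl fun i _ => ?_
          rw [Finset.sum_eq_single i]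
          · simp
          · intro j _ hj
            exact hoff i j hj.symm
          · simp
      _ = _ := by simp
  have hdiag : ∀ a c, Lop f a a c = (#{i | c i = a} : ℚ) * f c := by
    intro a c
    simp only [Lop]
    have : ∀ i, (if c i = a then f (Function.update c i a) else 0) = if c i = a then f c else 0 := by
      intro i
      split_ifs with h
      · subst h; simp
      · rfl
    simp only [this, ← Finset.sum_filter]
    simp
  have hge : ∑ c, ∑ a, ((#{i | c i = a} : ℚ) * f c)^2 ≤ ∑ a, ∑ b, ∑ c, Lop f a b c * Lop f b a c := by
    rw [Finset.sum_comm]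
    refine Finset.sum_le_sum fun a _ => ?_
    have := Finset.single_le_sum (s := univ) (f := fun b => ∑ c, Lop f a b c * Lop f b a c) (by
      intro b _
      refine Finset.sum_nonneg fun c _ => ?_
      rw [lie_q f hf b a c]; exact mul_self_nonneg _) (mem_univ a)
    refine le_trans (le_of_eq ?_) this
    refine Finset.sum_congr rfl fun c _ => ?_
    rw [hdiag]; ring
  have hcard : ∀ c : ι → Fin k, (Fintype.card ι : ℚ) = ∑ a, (#{i | c i = a} : ℚ) := by
    intro c
    have := Finset.card_eq_sum_card_fiberwise (s := (univ : Finset ι)) (t := univ) (f := c) (by simp)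
    rw [← Finset.card_univ, this]; push_cast; rfl
  rw [main, Finset.mul_sum] at hge
  have hterm : ∀ c a, 0 ≤ ((#{i | c i = a} : ℚ) * f c)^2 - (#{i | c i = a} : ℚ) * (f c * f c) := by
    intro c a
    rcases Nat.eq_zero_or_pos (#{i | c i = a}) with h | h
    · simp [h]
    · have : (1 : ℚ) ≤ (#{i | c i = a} : ℚ) := by exact_mod_cast h
      have : ((#{i | c i = a} : ℚ) * f c)^2 - (#{i | c i = a} : ℚ) * (f c * f c) = (#{i | c i = a} : ℚ) * (#{i | c i = a} - 1) * (f c * f c) := by ring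
      rw [this]
      have := mul_self_nonneg (f c)
      have h1 : (0 : ℚ) ≤ (#{i | c i = a} : ℚ) - 1 := by linarith
      positivity
  have hsum : ∑ c, ∑ a, (((#{i | c i = a} : ℚ) * f c)^2 - (#{i | c i = a} : ℚ) * (f c * f c)) ≤ 0 := by
    have : ∀ c : ι → Fin k, (Fintype.card ι : ℚ) * (f c * f c) = ∑ a, (#{i | c i = a} : ℚ) * (f c * f c) := by
      intro c; rw [← Finset.sum_mul, ← hcard c]
    simp only [this] at hge
    simp only [Finset.sum_sub_distrib]
    linarith
  have hz := (Finset.sum_eq_zero_iff_of_nonneg (s := univ) (fun c _ => Finset.sum_nonneg fun a _ => hterm c a)).mp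
    (le_antisymm hsum (Finset.sum_nonneg fun c _ => Finset.sum_nonneg fun a _ => hterm c a))
  funext c
  obtain ⟨i0⟩ := ‹Nonempty ι›
  have h1 := (Finset.sum_eq_zero_iff_of_nonneg (s := univ) (fun a _ => hterm c a)).mp (hz c (mem_univ c)) (c i0) (mem_univ _)
  by_contra hne
  have heven : Even (#{i | c i = c i0}) := by
    by_contra hodd
    exact hne (parity_q f hf c (c i0) (Nat.not_even_iff_odd.mp hodd))
  have hpos : 0 < #{i | c i = c i0} := Finset.card_pos.mpr ⟨i0, by simp⟩
  have h2 : 2 ≤ #{i | c i = c i0} := by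
    obtain ⟨m, hm⟩ := heven; omega
  have h2' : (2 : ℚ) ≤ (#{i | c i = c i0} : ℚ) := by exact_mod_cast h2
  have h3 : (#{i | c i = c i0} : ℚ) * (#{i | c i = c i0} - 1) * (f c * f c) = 0 := by rw [← h1]; ring
  have hf0 : f c ≠ 0 := hne
  have h4 : (#{i | c i = c i0} : ℚ) - 1 ≠ 0 := by intro h; linarith
  have h5 : (#{i | c i = c i0} : ℚ) ≠ 0 := by intro h; linarith
  exact (mul_ne_zero (mul_ne_zero h5 h4) (mul_ne_zero hf0 hf0)) h3


def glueW (i j : ι) (c : {x // x ≠ i ∧ x ≠ j} → Fin k) (a b : Fin k) : ι → Fin k :=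
  fun x => if hi : x = i then a else if hj : x = j then b else c ⟨x, hi, hj⟩

theorem glueW_i (i j : ι) (c : {x // x ≠ i ∧ x ≠ j} → Fin k) (a b : Fin k) : glueW i j c a b i = a := by
  simp [glueW]

theorem glueW_j (i j : ι) (hij : i ≠ j) (c : {x // x ≠ i ∧ x ≠ j} → Fin k) (a b : Fin k) :
    glueW i j c a b j = b := by
  simp [glueW, hij.symm]

theorem glueW_x (i j : ι) (c : {x // x ≠ i ∧ x ≠ j} → Fin k) (a b : Fin k) (x : {x // x ≠ i ∧ x ≠ j}) :
    glueW i j c a b x = c x := by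
  simp [glueW, x.2.1, x.2.2]

def glueEquiv (i j : ι) (hij : i ≠ j) :
    ({x // x ≠ i ∧ x ≠ j} → Fin k) × Fin k × Fin k ≃ (ι → Fin k) where
  toFun p := glueW i j p.1 p.2.1 p.2.2
  invFun c := (fun x => c x, c i, c j)
  left_inv := by
    rintro ⟨c, a, b⟩
    simp [glueW_i, glueW_j _ _ hij, glueW_x]
  right_inv := by
    intro c
    funext x
    simp only [glueW]
    split_ifs with h1 h2
    · rw [h1]
    · rw [h2]
    · rfl

theorem sum_glue (i j : ι) (hij : i ≠ j) (F : (ι → Fin k) → ℚ) :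
    ∑ c, F c = ∑ c : {x // x ≠ i ∧ x ≠ j} → Fin k, ∑ a, ∑ b, F (glueW i j c a b) := by
  rw [← Equiv.sum_comp (glueEquiv i j hij), Fintype.sum_prod_type]
  refine Finset.sum_congr rfl fun c _ => ?_
  rw [Fintype.sum_prod_type]
  rfl

theorem prod_glue (i j : ι) (hij : i ≠ j) (h : ι → ℚ) :
    ∏ x, h x = (∏ x : {x // x ≠ i ∧ x ≠ j}, h x) * (h i * h j) := by
  rw [← Finset.mul_prod_erase univ h (mem_univ i),
    ← Finset.mul_prod_erase (univ.erase i) h (a := j) (by simp [hij.symm]),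
    Finset.prod_subtype (p := fun x => x ≠ i ∧ x ≠ j) ((univ.erase i).erase j) (by intro x; simp [and_comm])]
  ring

theorem orth_mul_transpose {S : Type} [CommRing S] (g : Matrix (Fin k) (Fin k) S) (hg : g.transpose * g = 1)
    (p q : Fin k) : ∑ b, g p b * g q b = if p = q then 1 else 0 := by
  have h : g * g.transpose = 1 := mul_eq_one_comm.mp hg
  have := congrFun (congrFun h p) q
  rw [Matrix.mul_apply, Matrix.one_apply] at this
  simpa using this

theorem inv_contract (f : (ι → Fin k) → ℚ) (hf : InvQ f) (i j : ι) (hij : i ≠ j) :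
    InvQ (fun c : {x // x ≠ i ∧ x ≠ j} → Fin k => ∑ a, f (glueW i j c a a)) := by
  intro g hg c
  have h : ∀ b, f (glueW i j c b b) = ∑ c' : {x // x ≠ i ∧ x ≠ j} → Fin k, ∑ p, ∑ q,
      (∏ x, g (c' x) (c x)) * (g p b * g q b) * f (glueW i j c' p q) := by
    intro b
    rw [← hf g hg, sum_glue i j hij]
    refine Finset.sum_congr rfl fun c' _ => Finset.sum_congr rfl fun p _ => Finset.sum_congr rfl fun q _ => ?_
    rw [prod_glue i j hij]
    simp only [glueW_i, glueW_j i j hij, glueW_x]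
  simp only [h]
  rw [Finset.sum_comm]
  refine Finset.sum_congr rfl fun c' _ => ?_
  rw [Finset.sum_comm, Finset.mul_sum]
  refine Finset.sum_congr rfl fun p _ => ?_
  rw [Finset.sum_comm]
  have : ∀ q, ∑ b, (∏ x, g (c' x) (c x)) * (g p b * g q b) * f (glueW i j c' p q)
      = if p = q then (∏ x, g (c' x) (c x)) * f (glueW i j c' p q) else 0 := by
    intro q
    rw [← Finset.sum_mul, ← Finset.mul_sum, orth_mul_transpose g hg]
    split_ifs <;> simp
  simp only [this]
  simp

theorem fft_q (n : ℕ) : ∀ (ι : Type) [Fintype ι] [DecidableEq ι], Fintype.card ι = n →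
    ∀ f : (ι → Fin k) → ℚ, InvQ f →
    (∀ (ε : Type) [Fintype ε] [DecidableEq ε] (e : ε ⊕ ε ≃ ι),
      ∑ κ : ε → Fin k, f (fun x => Sum.elim κ κ (e.symm x)) = 0) → f = 0 := by
  induction n using Nat.strong_induction_on with
  | _ n ih =>
  intro ι _ _ hcard f hf hm
  rcases isEmpty_or_nonempty ι with hE | hN
  · have h := hm Empty (Equiv.equivOfIsEmpty _ _)
    funext c
    rw [Fintype.sum_unique] at h
    rw [Subsingleton.elim c]
    exact h
  · apply core_q f hf
    intro i j hij c
    have hlt : Fintype.card {x // x ≠ i ∧ x ≠ j} < n := by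
      rw [← hcard]
      exact Fintype.card_subtype_lt (x := i) (by simp)
    have h0 := ih _ hlt {x // x ≠ i ∧ x ≠ j} rfl _ (inv_contract f hf i j hij) (by
      intro ε _ _ e
      let e1 : Option ε ⊕ Option ε → ι := Sum.elim
        (fun o => o.elim i (fun y => (e (Sum.inl y)).1)) (fun o => o.elim j (fun y => (e (Sum.inr y)).1))
      have hb : Function.Bijective e1 := by
        constructor
        · have n1 : ∀ z, (e z).1 ≠ i := fun z => (e z).2.1
          have n2 : ∀ z, (e z).1 ≠ j := fun z => (e z).2.2
          rintro ((_ | y) | (_ | y)) ((_ | y') | (_ | y')) h <;>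
            simp [e1, hij, hij.symm, n1, n2, (n1 _).symm, (n2 _).symm, Subtype.val_inj] at h ⊢ <;> exact h
        · intro x
          by_cases hi : x = i
          · exact ⟨Sum.inl none, by simp [e1, hi]⟩
          by_cases hj : x = j
          · exact ⟨Sum.inr none, by simp [e1, hj]⟩
          obtain ⟨y, hy⟩ := e.surjective ⟨x, hi, hj⟩
          rcases y with y | y
          · exact ⟨Sum.inl (some y), by simp [e1, hy]⟩
          · exact ⟨Sum.inr (some y), by simp [e1, hy]⟩
      have h := hm (Option ε) (Equiv.ofBijective e1 hb)
      rw [← Equiv.sum_comp (Equiv.piOptionEquivProd (β := fun _ => Fin k)).symm, Fintype.sum_prod_type, Finset.sum_comm] at h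
      rw [← h]
      refine Finset.sum_congr rfl fun κ _ => Finset.sum_congr rfl fun a _ => ?_
      congr 1
      funext x
      obtain ⟨y, rfl⟩ := (Equiv.ofBijective e1 hb).surjective x
      rw [Equiv.symm_apply_apply]
      rcases y with (_ | y) | (_ | y)
      · simp [e1, glueW_i]
      · simp [e1, glueW_x]
      · simp [e1, glueW_j i j hij]
      · simp [e1, glueW_x])
    have h1 := congrFun h0 (fun x => c x)
    simp only [Pi.zero_apply] at h1
    rw [← h1]
    refine Finset.sum_congr rfl fun a _ => ?_
    congr 1
    funext x
    by_cases hj : x = j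
    · subst hj; simp [glueW_j i _ hij]
    by_cases hi : x = i
    · subst hi; simp [glueW_i, Function.update_of_ne hj]
    · simp [glueW, hi, hj, Function.update_of_ne]

end CoreQ

section Appl
open Finset

def cnt1 {σ : Type} [Fintype σ] {k : ℕ} (c : σ → Fin k) : Fin k → ℕ :=
  fun a => ∑ i, if c i = a then 1 else 0

def cntW {ι Q : Type} [Fintype ι] [DecidableEq Q] {k : ℕ} (φ : ι → Q) (c : ι → Fin k) (q : Q) : Fin k → ℕ :=
  fun a => ∑ i, if φ i = q then (if c i = a then 1 else 0) else 0

noncomputable def monW (F : Type) [CommRing F] {ι Q : Type} [Fintype ι] [Fintype Q] [DecidableEq Q] {k : ℕ}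
    (φ : ι → Q) (c : ι → Fin k) : PolyR F k :=
  ∏ q, X (cntW φ c q)

theorem cntW_eq_cnt1 {ι Q : Type} [Fintype ι] [DecidableEq Q] {k : ℕ} (φ : ι → Q) (c : ι → Fin k) (q : Q) :
    cntW φ c q = cnt1 (fun i : {i // φ i = q} => c i) := by
  funext a
  simp only [cntW, cnt1]
  rw [← Finset.sum_filter]
  rw [Finset.sum_subtype (p := fun i => φ i = q) _ (by simp)]

variable {F : Type} [Field F] {k : ℕ}

theorem monToVar_subset (q : MvPolynomial (Fin k) F) (S : Finset (Fin k →₀ ℕ)) (h : q.support ⊆ S) :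
    monToVar F k q = ∑ d ∈ S, C (q.coeff d) * X (⇑d : Fin k → ℕ) := by
  rw [monToVar]
  apply Finset.sum_subset h
  intro d _ hd
  rw [MvPolynomial.notMem_support_iff.mp hd]; simp

theorem monToVar_add (p q : MvPolynomial (Fin k) F) :
    monToVar F k (p + q) = monToVar F k p + monToVar F k q := by
  classical
  rw [monToVar_subset (p + q) (p.support ∪ q.support) MvPolynomial.support_add,
    monToVar_subset p (p.support ∪ q.support) Finset.subset_union_left,
    monToVar_subset q (p.support ∪ q.support) Finset.subset_union_right, ← Finset.sum_add_distrib]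
  refine Finset.sum_congr rfl fun d _ => ?_
  rw [MvPolynomial.coeff_add, C_add, add_mul]

theorem monToVar_sum {A : Type} (s : Finset A) (p : A → MvPolynomial (Fin k) F) :
    monToVar F k (∑ a ∈ s, p a) = ∑ a ∈ s, monToVar F k (p a) := by
  classical
  induction s using Finset.induction_on with
  | empty => simp [monToVar]
  | insert a s ha ih => rw [Finset.sum_insert ha, Finset.sum_insert ha, monToVar_add, ih]

theorem monToVar_monomial (d : Fin k →₀ ℕ) (a : F) :
    monToVar F k (monomial d a) = C a * X (⇑d : Fin k → ℕ) := by
  classical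
  rw [monToVar_subset _ {d} MvPolynomial.support_monomial_subset]
  simp

theorem gAct_X_cnt1 {σ : Type} [Fintype σ] [DecidableEq σ] (g : Matrix (Fin k) (Fin k) F) (c : σ → Fin k) :
    gAct g (X (cnt1 c)) = ∑ c' : σ → Fin k, C (∏ i, g (c' i) (c i)) * X (cnt1 c') := by
  rw [gAct, aeval_X]
  have h1 : (∏ a, X a ^ cnt1 c a : MvPolynomial (Fin k) F) = ∏ i, X (c i) := by
    simp only [cnt1, ← Finset.prod_pow_eq_pow_sum]
    rw [Finset.prod_comm]
    refine Finset.prod_congr rfl fun i _ => ?_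
    rw [Finset.prod_eq_single (c i)]
    · simp
    · intro b _ hb; simp [hb.symm]
    · simp
  rw [h1, map_prod]
  simp only [substAct, aeval_X]
  rw [Finset.prod_univ_sum, Fintype.piFinset_univ, monToVar_sum]
  refine Finset.sum_congr rfl fun c' _ => ?_
  have h2 : (∏ i, (C (g (c' i) (c i)) * X (c' i)) : MvPolynomial (Fin k) F)
      = monomial (∑ i, Finsupp.single (c' i) 1) (∏ i, g (c' i) (c i)) := by
    rw [MvPolynomial.monomial_sum_index, Finset.prod_mul_distrib, map_prod]
    rfl
  rw [h2, monToVar_monomial]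
  congr 2
  funext a
  simp [cnt1, Finsupp.single_apply]

def restrEquiv {ι Q : Type} (φ : ι → Q) (k : ℕ) :
    (ι → Fin k) ≃ ((q : Q) → {i // φ i = q} → Fin k) where
  toFun c q i := c i
  invFun p i := p (φ i) ⟨i, rfl⟩
  left_inv c := rfl
  right_inv p := by
    funext q i
    obtain ⟨i, rfl⟩ := i
    rfl

theorem gAct_monW {ι Q : Type} [Fintype ι] [DecidableEq ι] [Fintype Q] [DecidableEq Q]
    (g : Matrix (Fin k) (Fin k) F) (φ : ι → Q) (c : ι → Fin k) :
    gAct g (monW F φ c) = ∑ c' : ι → Fin k, (∏ i, g (c' i) (c i)) • monW F φ c' := by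
  simp only [monW, cntW_eq_cnt1, map_prod, gAct_X_cnt1]
  rw [Finset.prod_univ_sum, Fintype.piFinset_univ, ← Equiv.sum_comp (restrEquiv φ k)]
  refine Finset.sum_congr rfl fun c' _ => ?_
  rw [Finset.prod_mul_distrib, MvPolynomial.smul_eq_C_mul]
  congr 1
  rw [map_prod]
  exact Fintype.prod_fiberwise φ (fun i => (C (g (c' i) (c i)) : PolyR F k))

theorem monW_equiv {ι Q Q' : Type} [Fintype ι] [Fintype Q] [DecidableEq Q] [Fintype Q'] [DecidableEq Q']
    (E : Q ≃ Q') (φ : ι → Q) (c : ι → Fin k) : monW F φ c = monW F (fun i => E (φ i)) c := by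
  rw [monW, monW, ← Equiv.prod_comp E]
  refine Finset.prod_congr rfl fun q _ => ?_
  congr 1
  funext a
  simp [cntW]

theorem pPoly_eq (H : MGraph) {ι : Type} [Fintype ι] (e : H.E ⊕ H.E ≃ ι) (φ : ι → H.V)
    (he : ∀ x, H.ends x = (φ (e (Sum.inl x)), φ (e (Sum.inr x)))) :
    pPoly F k H = ∑ κ : H.E → Fin k, monW F φ (fun x => Sum.elim κ κ (e.symm x)) := by
  rw [pPoly]
  refine Finset.sum_congr rfl fun κ _ => ?_
  rw [monW]
  refine Finset.prod_congr rfl fun v _ => ?_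
  congr 1
  funext a
  simp only [MGraph.degVec, cntW, MGraph.inc, he]
  rw [← Equiv.sum_comp e, Fintype.sum_sum_type, ← Finset.sum_add_distrib]
  refine Finset.sum_congr rfl fun x _ => ?_
  simp only [Equiv.symm_apply_apply, Sum.elim_inl, Sum.elim_inr]
  split_ifs <;> simp

theorem pPoly_inv (H : MGraph) : OkInvariant (pPoly F k H) := by
  classical
  intro g hg
  rw [pPoly_eq H (Equiv.refl _) (Sum.elim (fun x => (H.ends x).1) (fun x => (H.ends x).2)) (by intro x; rfl)]
  rw [map_sum]
  simp only [gAct_monW]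
  rw [Finset.sum_comm]
  simp only [← Finset.sum_smul, Equiv.refl_symm, Equiv.refl_apply, Fintype.prod_sum_type, Sum.elim_inl, Sum.elim_inr,
    ← Finset.prod_mul_distrib]
  have h1 : ∀ c' : H.E ⊕ H.E → Fin k, ∑ κ : H.E → Fin k, ∏ x, (g (c' (Sum.inl x)) (κ x) * g (c' (Sum.inr x)) (κ x))
      = if ∀ x, c' (Sum.inl x) = c' (Sum.inr x) then 1 else 0 := by
    intro c'
    have := Finset.prod_univ_sum (ι := H.E) (fun _ => (univ : Finset (Fin k))) (fun x b => g (c' (Sum.inl x)) b * g (c' (Sum.inr x)) b)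
    rw [Fintype.piFinset_univ] at this
    rw [← this]
    simp only [orth_mul_transpose g hg]
    rw [Finset.prod_ite_zero]; simp
  simp only [h1]
  symm
  apply Finset.sum_of_injOn (fun κ => fun x => Sum.elim κ κ x)
  · intro κ _ κ' _ h
    funext x
    exact congrFun h (Sum.inl x)
  · simp
  · intro c' _ hc'
    rw [if_neg, zero_smul]
    intro hall
    apply hc'
    refine ⟨fun x => c' (Sum.inl x), by simp, ?_⟩
    funext x
    rcases x with x | x
    · rfl
    · exact hall x
  · intro κ _
    simp

def slotGraph {V ε ι : Type} [Fintype V] [DecidableEq V] [Fintype ε] [DecidableEq ε] (vert : ι → V) (e : ε ⊕ ε ≃ ι) :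
    MGraph where
  V := V
  E := ε
  ends := fun x => (vert (e (Sum.inl x)), vert (e (Sum.inr x)))

def noEdge (V : Type) [Fintype V] [DecidableEq V] : MGraph where
  V := V
  E := Empty
  ends := Empty.elim

def qmk {V : Type} [Fintype V] [DecidableEq V] (U : Finset V) (t : {v // v ∈ U} → V) (v : V) :
    ((noEdge V).contract U t).V :=
  Quotient.mk (Relation.EqvGen.setoid (fun a b => ∃ h : a ∈ U, t ⟨a, h⟩ = b)) v

theorem pPoly_contract {V ε ι : Type} [Fintype V] [DecidableEq V] [Fintype ε] [DecidableEq ε] [Fintype ι]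
    (vert : ι → V) (e : ε ⊕ ε ≃ ι) (U : Finset V) (t : {v // v ∈ U} → V) :
    pPoly F k ((slotGraph vert e).contract U t)
      = ∑ κ : ε → Fin k, monW F (fun i => qmk U t (vert i)) (fun x => Sum.elim κ κ (e.symm x)) :=
  pPoly_eq ((slotGraph vert e).contract U t) (ι := ι) e (fun i => qmk U t (vert i)) (fun x => rfl)

abbrev VV (r : ℕ) (Λ : Type) : Type := Fin (r + 1) ⊕ Fin (r + 1) ⊕ Λ

def hmap {r : ℕ} {Λ : Type} (σ : Equiv.Perm (Fin (r + 1))) : VV r Λ → Fin (r + 1) ⊕ Λ :=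
  Sum.elim Sum.inl (Sum.elim (fun j => Sum.inl (σ.symm j)) Sum.inr)

def rmap {r : ℕ} {Λ : Type} : Fin (r + 1) ⊕ Λ → VV r Λ :=
  Sum.elim Sum.inl (fun l => Sum.inr (Sum.inr l))

theorem exists_qequiv {r : ℕ} {Λ : Type} [Fintype Λ] [DecidableEq Λ] (U : Finset (VV r Λ))
    (t : {v // v ∈ U} → VV r Λ) (σ : Equiv.Perm (Fin (r + 1)))
    (hU : ∀ v, v ∈ U ↔ ∃ i, Sum.inl i = v)
    (ht : ∀ i (h : Sum.inl i ∈ U), t ⟨Sum.inl i, h⟩ = Sum.inr (Sum.inl (σ i))) :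
    ∃ E : ((noEdge (VV r Λ)).contract U t).V ≃ Fin (r + 1) ⊕ Λ, ∀ v, E (qmk U t v) = hmap σ v := by
  let s : Setoid (VV r Λ) := Relation.EqvGen.setoid (fun a b => ∃ h : a ∈ U, t ⟨a, h⟩ = b)
  have hresp : ∀ a b, Relation.EqvGen (fun a b => ∃ h : a ∈ U, t ⟨a, h⟩ = b) a b → hmap σ a = hmap σ b := by
    intro a b hab
    induction hab with
    | rel a b h =>
      obtain ⟨ha, hb⟩ := h
      obtain ⟨i, rfl⟩ := (hU a).mp ha
      rw [ht] at hb
      subst hb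
      simp [hmap]
    | refl a => rfl
    | symm a b _ ih => exact ih.symm
    | trans a b c _ _ ih1 ih2 => exact ih1.trans ih2
  have hrep : ∀ v, (Quotient.mk s v) = Quotient.mk s (rmap (hmap σ v)) := by
    rintro (i | j | l)
    · rfl
    · symm
      apply Quotient.sound
      apply Relation.EqvGen.rel
      have hm : (Sum.inl (σ.symm j) : VV r Λ) ∈ U := (hU _).mpr ⟨_, rfl⟩
      refine ⟨hm, ?_⟩
      have := ht (σ.symm j) hm
      rw [Equiv.apply_symm_apply] at this
      exact this
    · rfl
  let L : Quotient s → Fin (r + 1) ⊕ Λ := Quotient.lift (hmap σ) hresp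
  have hL : Function.Bijective L := by
    constructor
    · intro x y hxy
      induction x using Quotient.inductionOn
      induction y using Quotient.inductionOn
      rename_i a b
      have : hmap σ a = hmap σ b := hxy
      rw [hrep a, hrep b, this]
    · intro w
      refine ⟨Quotient.mk s (rmap w), ?_⟩
      rcases w with i | l <;> rfl
  exact ⟨Equiv.ofBijective L hL, fun v => rfl⟩

abbrev Slots {V : Type} {k : ℕ} (D : V → Fin k → ℕ) : Type := (v : V) × (a : Fin k) × Fin (D v a)

theorem cntW_slots {V W : Type} [Fintype V] [DecidableEq W] (D : V → Fin k → ℕ) (h : V → W) (w : W) (a : Fin k) :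
    cntW (fun i : Slots D => h i.1) (fun i => i.2.1) w a = ∑ v, if h v = w then D v a else 0 := by
  simp only [cntW, Fintype.sum_sigma]
  refine Finset.sum_congr rfl fun v _ => ?_
  split_ifs
  · rw [Finset.sum_eq_single a]
    · simp
    · intro b _ hb; simp [hb]
    · simp
  · simp

theorem monW_slots {r : ℕ} {Λ : Type} [Fintype Λ] [DecidableEq Λ]
    (α β : Fin (r + 1) → Fin k → ℕ) (γ : Λ → Fin k → ℕ) (σ : Equiv.Perm (Fin (r + 1))) :
    monW F (fun i : Slots (Sum.elim α (Sum.elim β γ)) => hmap σ i.1) (fun i => i.2.1)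
      = (∏ i, X (α i + β (σ i))) * ∏ l, X (γ l) := by
  rw [monW, Fintype.prod_sum_type]
  congr 1
  · refine Finset.prod_congr rfl fun i _ => ?_
    congr 1
    funext a
    rw [cntW_slots]
    simp [Fintype.sum_sum_type, hmap, Equiv.symm_apply_eq]
  · refine Finset.prod_congr rfl fun i _ => ?_
    congr 1
    funext a
    rw [cntW_slots]
    simp [Fintype.sum_sum_type, hmap]

noncomputable def Jspan (F : Type) [Field F] (r : ℕ) : Submodule F (MGraph →₀ F) := Submodule.span F
      {x : MGraph →₀ F | ∃ (G : MGraph) (U : Finset G.V) (t : {v // v ∈ U} → G.V),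
        U.card = r + 1 ∧ (∀ u, t u ∉ U) ∧
        x = ∑ π : Equiv.Perm {v // v ∈ U},
          ((Equiv.Perm.sign π : ℤ) : F) • Finsupp.single (G.contract U (t ∘ π)) 1}

theorem claim_prod [CharZero F] (r : ℕ)
    (ρ : PolyR F k →ₗ[F] PolyR F k)
    (hid : ∀ x : PolyR F k, OkInvariant x → ρ x = x)
    (hequiv : ∀ (g : Matrix (Fin k) (Fin k) F), g.transpose * g = 1 →
      ∀ x : PolyR F k, ρ (gAct g x) = ρ x)
    (α β : Fin (r + 1) → (Fin k → ℕ)) (Λ : Type) [Fintype Λ] [DecidableEq Λ] (γ : Λ → Fin k → ℕ) :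
    ρ ((∏ l, X (γ l)) * (Matrix.of fun i j => (X (α i + β j) : PolyR F k)).det) ∈
      Submodule.map (pLin F k) (Jspan F r) := by
  let D : VV r Λ → Fin k → ℕ := Sum.elim α (Sum.elim β γ)
  let U : Finset (VV r Λ) := univ.map ⟨Sum.inl, Sum.inl_injective⟩
  have hU : ∀ v, v ∈ U ↔ ∃ i, Sum.inl i = v := by intro v; simp [U]
  have hUc : U.card = r + 1 := by rw [Finset.card_map]; simp
  let e0 : Fin (r + 1) ≃ {v // v ∈ U} := Equiv.ofBijective (fun i => ⟨Sum.inl i, (hU _).mpr ⟨i, rfl⟩⟩) (by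
    constructor
    · intro i j h; simpa using h
    · rintro ⟨v, hv⟩
      obtain ⟨i, rfl⟩ := (hU v).mp hv
      exact ⟨i, rfl⟩)
  let t : {v // v ∈ U} → VV r Λ := fun u => Sum.inr (Sum.inl (e0.symm u))
  let Ψ : (Slots D → Fin k) → PolyR F k := fun c =>
    ∑ π : Equiv.Perm {v // v ∈ U}, ((Equiv.Perm.sign π : ℤ) : F) • monW F (fun i : Slots D => qmk U (t ∘ π) i.1) c
  let c0 : Slots D → Fin k := fun i => i.2.1
  have hc0 : Ψ c0 = (∏ l, X (γ l)) * (Matrix.of fun i j => (X (α i + β j) : PolyR F k)).det := by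
    rw [← Matrix.det_transpose, Matrix.det_apply, Finset.mul_sum, ← Equiv.sum_comp e0.symm.permCongr]
    refine Finset.sum_congr rfl fun π _ => ?_
    obtain ⟨E, hE⟩ := exists_qequiv U (t ∘ π) (e0.symm.permCongr π) hU (by
      intro i h
      rfl)
    rw [monW_equiv E]
    simp only [hE]
    have := monW_slots (F := F) α β γ (e0.symm.permCongr π)
    rw [show monW F (fun i : Slots D => hmap (e0.symm.permCongr π) i.fst) c0 = _ from this]
    rw [Equiv.Perm.sign_permCongr, mul_comm (∏ i, X _) (∏ l, X (γ l)), ← mul_smul_comm]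
    congr 1
    simp only [Matrix.transpose_apply, Matrix.of_apply]
    rw [Int.cast_smul_eq_zsmul]
    rfl
  have hmatch : ∀ (ε : Type) [Fintype ε] [DecidableEq ε] (e : ε ⊕ ε ≃ Slots D),
      ρ (∑ κ : ε → Fin k, Ψ (fun x => Sum.elim κ κ (e.symm x))) ∈ Submodule.map (pLin F k) (Jspan F r) := by
    intro ε _ _ e
    have h1 : ∑ κ : ε → Fin k, Ψ (fun x => Sum.elim κ κ (e.symm x))
        = ∑ π : Equiv.Perm {v // v ∈ U}, ((Equiv.Perm.sign π : ℤ) : F) •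
          pPoly F k ((slotGraph (fun i : Slots D => i.1) e).contract U (t ∘ π)) := by
      simp only [Ψ]
      rw [Finset.sum_comm]
      refine Finset.sum_congr rfl fun π _ => ?_
      rw [← Finset.smul_sum]
      congr 1
      exact (pPoly_contract (fun i : Slots D => i.1) e U (t ∘ π)).symm
    rw [h1, hid]
    · refine ⟨∑ π : Equiv.Perm {v // v ∈ U}, ((Equiv.Perm.sign π : ℤ) : F) •
          Finsupp.single ((slotGraph (fun i : Slots D => i.1) e).contract U (t ∘ π)) 1, ?_, ?_⟩
      · apply Submodule.subset_span
        refine ⟨slotGraph (fun i : Slots D => i.1) e, U, t, hUc, ?_, rfl⟩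
        intro u hu
        obtain ⟨i, hi⟩ := (hU _).mp hu
        simp [t] at hi
      · simp [pLin, Finsupp.linearCombination_single]
    · intro g hg
      rw [map_sum]
      refine Finset.sum_congr rfl fun π _ => ?_
      rw [map_smul, pPoly_inv _ g hg]
  rw [← hc0]
  by_contra hnot
  obtain ⟨φ, hφ, hker⟩ := Submodule.exists_le_ker_of_notMem
    (p := (Submodule.map (pLin F k) (Jspan F r)).restrictScalars ℚ) (v := ρ (Ψ c0)) hnot
  have hker' : ∀ x ∈ Submodule.map (pLin F k) (Jspan F r), φ x = 0 := fun x hx => hker hx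
  have hz := fft_q (k := k) _ (Slots D) rfl (fun c => φ (ρ (Ψ c))) (by
    intro g hg c
    have hgF : (g.map (algebraMap ℚ F)).transpose * (g.map (algebraMap ℚ F)) = 1 := by
      rw [← Matrix.transpose_map, ← Matrix.map_mul, hg]
      simp
    have h1 : gAct (g.map (algebraMap ℚ F)) (Ψ c) = ∑ c', (∏ i, g (c' i) (c i)) • Ψ c' := by
      simp only [Ψ, map_sum, map_smul, gAct_monW, Finset.smul_sum]
      rw [Finset.sum_comm]
      refine Finset.sum_congr rfl fun c' _ => Finset.sum_congr rfl fun π _ => ?_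
      have hp : ∏ i, (g.map (algebraMap ℚ F)) (c' i) (c i) = algebraMap ℚ F (∏ i, g (c' i) (c i)) := by
        rw [map_prod]; rfl
      rw [hp, algebraMap_smul, smul_comm]
    have h2 := hequiv _ hgF (Ψ c)
    change _ = φ (ρ (Ψ c))
    rw [← h2, h1, map_sum, map_sum]
    refine Finset.sum_congr rfl fun c' _ => ?_
    rw [← algebraMap_smul F (∏ i, g (c' i) (c i)) (Ψ c'), map_smul, algebraMap_smul, map_smul, smul_eq_mul]) (by
    intro ε _ _ e
    have := hker' _ (hmatch ε e)
    rw [map_sum, map_sum] at this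
    exact this)
  exact hφ (congrFun hz c0)

end Appl

/-- `ρ_{O_k}(𝓙) ⊆ p(J)`, where `𝓙 ⊆ R` is the ideal generated by the
`(r+1) × (r+1)` minors of the moment matrix `(y_{α+β})`, `J ⊆ FG` is the span of the
signed contraction quantum graphs, `p` is the partition-function map and `ρ` is the
Reynolds operator for the `O_k`-action on `R` (axiomatized by its characteristic
properties). -/
theorem reynolds_minors_subset_p_span
    (F : Type) [Field F] [IsAlgClosed F] [CharZero F] (k r : ℕ)
    (ρ : PolyR F k →ₗ[F] PolyR F k)
    (hinv : ∀ x : PolyR F k, OkInvariant (ρ x))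
    (hid : ∀ x : PolyR F k, OkInvariant x → ρ x = x)
    (hequiv : ∀ (g : Matrix (Fin k) (Fin k) F), g.transpose * g = 1 →
      ∀ x : PolyR F k, ρ (gAct g x) = ρ x) :
    letI 𝓙 : Ideal (PolyR F k) := Ideal.span
      {x : PolyR F k | ∃ α β : Fin (r + 1) → (Fin k → ℕ),
        x = (Matrix.of fun i j => (X (α i + β j) : PolyR F k)).det}
    letI J : Submodule F (MGraph →₀ F) := Submodule.span F
      {x : MGraph →₀ F | ∃ (G : MGraph) (U : Finset G.V) (t : {v // v ∈ U} → G.V),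
        U.card = r + 1 ∧ (∀ u, t u ∉ U) ∧
        x = ∑ π : Equiv.Perm {v // v ∈ U},
          ((Equiv.Perm.sign π : ℤ) : F) • Finsupp.single (G.contract U (t ∘ π)) 1}
    ⇑ρ '' (𝓙 : Set (PolyR F k)) ⊆ ⇑(pLin F k) '' (J : Set (MGraph →₀ F)) := by
  rintro _ ⟨x, hx, rfl⟩
  change ρ x ∈ Submodule.map (pLin F k) (Jspan F r)
  have hgen : ∀ (α β : Fin (r + 1) → (Fin k → ℕ)) (a : PolyR F k) (Λ : Type) [Fintype Λ] [DecidableEq Λ]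
      (γ : Λ → Fin k → ℕ),
      ρ (a * ((∏ l, X (γ l)) * (Matrix.of fun i j => (X (α i + β j) : PolyR F k)).det)) ∈
        Submodule.map (pLin F k) (Jspan F r) := by
    intro α β a
    induction a using MvPolynomial.induction_on with
    | C c =>
      intro Λ _ _ γ
      rw [← MvPolynomial.smul_eq_C_mul, map_smul]
      exact Submodule.smul_mem _ _ (claim_prod r ρ hid hequiv α β Λ γ)
    | add p q hp hq =>
      intro Λ _ _ γ
      rw [add_mul, map_add]
      exact Submodule.add_mem _ (hp Λ γ) (hq Λ γ)
    | mul_X p m hp =>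
      intro Λ _ _ γ
      have := hp (Option Λ) (fun o => o.elim m γ)
      rw [Fintype.prod_option] at this
      simp only [Option.elim_none, Option.elim_some] at this
      rw [← mul_assoc, ← mul_assoc] at this
      rw [← mul_assoc]
      exact this
  refine Submodule.span_induction (p := fun x _ => ∀ a, ρ (a * x) ∈ Submodule.map (pLin F k) (Jspan F r))
    ?_ ?_ ?_ ?_ hx 1 |> fun h => by simpa using h
  · rintro _ ⟨α, β, rfl⟩ a
    have := hgen α β a Empty Empty.elim
    simpa using this
  · intro a; simp
  · intro x y _ _ hx hy a
    rw [mul_add, map_add]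
    exact Submodule.add_mem _ (hx a) (hy a)
  · intro b x _ hx a
    rw [smul_eq_mul, ← mul_assoc]
    exact hx _
end
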